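/- Suppose n, d → ∞ with n/d² → α ∈ (0,∞). Then for each fixed i, the signal percentile Ω_i^{(n)} converges in distribution to the random variable Ω = Φ(α^{−1/2} + Z), where Z is standard normal; equivalently, the limit law has CDF F(ω) = Φ(Φ^{−1}(ω) − α^{−1/2}) for ω ∈ (0,1) and density f(ω) = exp(Φ^{−1}(ω)/√α − 1/(2α)) on (0,1). -/

import Mathlib

open MeasureTheory ProbabilityTheory Filter Topology Matrix

noncomputable section

/-- The law `N(0, I_d/d)` on `ℝ^d`. -/
def stdGaussianVec (d : ℕ) : Measure (Fin d → ℝ) :=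
  Measure.pi fun _ => gaussianReal 0 (d : NNReal)⁻¹

/-- The Gaussian model: `u_1, …, u_n, v_1, …, v_n` mutually independent `N(0, I_d/d)`. -/
def gaussianModel (d n : ℕ) :
    Measure ((Fin n → Fin d → ℝ) × (Fin n → Fin d → ℝ)) :=
  (Measure.pi fun _ : Fin n => stdGaussianVec d).prod
    (Measure.pi fun _ : Fin n => stdGaussianVec d)

/-- The correlation matrix memory `W^× = U Vᵀ`. -/
def Wcross {d n : ℕ} (u v : Fin n → Fin d → ℝ) : Matrix (Fin d) (Fin d) ℝ :=
  Matrix.of fun a b => ∑ i, u i a * v i b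

/-- The score `s_{j,i} = u_j^⊤ W^× v_i` under the correlation matrix memory. -/
def scoreX {d n : ℕ} (u v : Fin n → Fin d → ℝ) (j i : Fin n) : ℝ :=
  u j ⬝ᵥ (Wcross u v).mulVec (v i)

/-- The signal percentile `Ω_i^{(n)} = (1/(n-1)) Σ_{j ≠ i} 1{ s_{i,i} ≥ s_{j,i} }`. -/
def percentile {d n : ℕ} (p : (Fin n → Fin d → ℝ) × (Fin n → Fin d → ℝ))
    (i : Fin n) : ℝ :=
  (∑ j ∈ Finset.univ.erase i,
      if scoreX p.1 p.2 j i ≤ scoreX p.1 p.2 i i then (1 : ℝ) else 0) / ((n : ℝ) - 1)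

/-- The standard normal CDF `Φ`. -/
def Phi (x : ℝ) : ℝ := (gaussianReal 0 1 (Set.Iic x)).toReal


instance (d : ℕ) : IsProbabilityMeasure (stdGaussianVec d) := by
  unfold stdGaussianVec; infer_instance

instance (d n : ℕ) : IsProbabilityMeasure (gaussianModel d n) := by
  unfold gaussianModel; infer_instance

lemma vec_charfun (d : ℕ) (w : Fin d → ℝ) :
    ∫ x, Complex.exp (((x ⬝ᵥ w : ℝ) : ℂ) * Complex.I) ∂stdGaussianVec d
      = Complex.exp (-(((w ⬝ᵥ w) / (2 * d) : ℝ) : ℂ)) := by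
  have h1 : ∀ x : Fin d → ℝ, Complex.exp (((x ⬝ᵥ w : ℝ) : ℂ) * Complex.I)
      = ∏ a, Complex.exp ((w a : ℂ) * (x a : ℂ) * Complex.I) := by
    intro x
    rw [← Complex.exp_sum, ← Finset.sum_mul]
    congr 2
    simp [dotProduct, mul_comm]
  simp_rw [h1]
  unfold stdGaussianVec
  rw [integral_fintype_prod_eq_prod (f := fun a (x : ℝ) => Complex.exp ((w a : ℂ) * (x : ℂ) * Complex.I))]
  have h2 : ∀ a, ∫ x : ℝ, Complex.exp ((w a : ℂ) * (x : ℂ) * Complex.I) ∂gaussianReal 0 (d : NNReal)⁻¹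
      = Complex.exp (-(((w a * w a) / (2 * d) : ℝ) : ℂ)) := by
    intro a
    rw [← charFun_apply_real, charFun_gaussianReal]
    congr 1
    push_cast
    simp
    ring
  simp_rw [h2]
  rw [← Complex.exp_sum]
  congr 1
  simp [dotProduct, Finset.sum_div]

lemma vec_map_dot (d : ℕ) (b : Fin d → ℝ) :
    (stdGaussianVec d).map (fun x => x ⬝ᵥ b)
      = gaussianReal 0 (Real.toNNReal ((b ⬝ᵥ b) / d)) := by
  have hm : Measurable (fun x : Fin d → ℝ => x ⬝ᵥ b) := by
    unfold dotProduct; fun_prop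
  have : IsProbabilityMeasure ((stdGaussianVec d).map (fun x => x ⬝ᵥ b)) :=
    Measure.isProbabilityMeasure_map hm.aemeasurable
  apply Measure.ext_of_charFun
  ext t
  rw [charFun_gaussianReal, charFun_apply_real, integral_map hm.aemeasurable (by fun_prop)]
  have := vec_charfun d (t • b)
  simp only [dotProduct_smul, smul_dotProduct, smul_eq_mul] at this
  have hb : 0 ≤ b ⬝ᵥ b / d := by
    apply div_nonneg _ (by positivity)
    simp only [dotProduct]
    exact Finset.sum_nonneg fun i _ => mul_self_nonneg _
  rw [Real.coe_toNNReal _ hb]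
  push_cast at this ⊢
  rw [this]
  congr 1
  ring

lemma gauss_exp_sq (s : NNReal) (l : ℝ) (hl : 0 ≤ l) :
    ∫ x, Real.exp (-l * x ^ 2) ∂gaussianReal 0 s = 1 / Real.sqrt (1 + 2 * l * s) := by
  rcases eq_or_ne s 0 with rfl | hs
  · simp [gaussianReal_zero_var]
  rw [integral_gaussianReal_eq_integral_smul hs]
  have hs' : 0 < (s : ℝ) := by positivity
  have h1 : ∀ x : ℝ, gaussianPDFReal 0 s x • Real.exp (-l * x ^ 2)
      = (Real.sqrt (2 * Real.pi * s))⁻¹ * Real.exp (-(l + 1 / (2 * s)) * x ^ 2) := by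
    intro x
    rw [gaussianPDFReal_def, smul_eq_mul, mul_assoc, ← Real.exp_add]
    congr 2
    field_simp
    ring
  simp_rw [h1]
  rw [integral_const_mul, integral_gaussian, ← Real.sqrt_inv, ← Real.sqrt_mul (by positivity),
    one_div (Real.sqrt _), ← Real.sqrt_inv]
  congr 1
  have := Real.pi_pos
  field_simp
  ring

/-- the joint characteristic function of one pair -/
lemma pair_charfun (d : ℕ) (b y : Fin d → ℝ) :
    ∫ x : (Fin d → ℝ) × (Fin d → ℝ), Complex.exp ((((x.2 ⬝ᵥ b) * (x.1 ⬝ᵥ y) : ℝ) : ℂ) * Complex.I)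
      ∂((stdGaussianVec d).prod (stdGaussianVec d))
      = ((1 / Real.sqrt (1 + (b ⬝ᵥ b) * (y ⬝ᵥ y) / d ^ 2) : ℝ) : ℂ) := by
  have hm : Measurable (fun x : Fin d → ℝ => x ⬝ᵥ b) := by
    unfold dotProduct; fun_prop
  have hb : 0 ≤ b ⬝ᵥ b := by
    simp only [dotProduct]
    exact Finset.sum_nonneg fun i _ => mul_self_nonneg _
  have hy : 0 ≤ y ⬝ᵥ y := by
    simp only [dotProduct]
    exact Finset.sum_nonneg fun i _ => mul_self_nonneg _
  rw [integral_prod_symm]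
  · have h1 : ∀ v : Fin d → ℝ, ∫ u, Complex.exp ((((v ⬝ᵥ b) * (u ⬝ᵥ y) : ℝ) : ℂ) * Complex.I)
        ∂stdGaussianVec d = ((Real.exp (- ((y ⬝ᵥ y) / (2 * d)) * (v ⬝ᵥ b) ^ 2) : ℝ) : ℂ) := by
      intro v
      have := vec_charfun d ((v ⬝ᵥ b) • y)
      simp only [dotProduct_smul, smul_dotProduct, smul_eq_mul] at this
      rw [this]
      push_cast
      congr 1
      ring
    simp_rw [h1]
    rw [integral_complex_ofReal]
    congr 1
    have := integral_map (μ := stdGaussianVec d) hm.aemeasurable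
      (f := fun z => Real.exp (-((y ⬝ᵥ y) / (2 * d)) * z ^ 2)) (by fun_prop)
    rw [← this, vec_map_dot, gauss_exp_sq _ _ (by positivity), Real.coe_toNNReal _ (by positivity)]
    congr 3
    ring
  · apply Integrable.of_bound (C := 1)
    · apply Measurable.aestronglyMeasurable
      unfold dotProduct; fun_prop
    · refine Filter.Eventually.of_forall fun x => ?_
      rw [Complex.norm_exp_ofReal_mul_I]




lemma coord_mp (d : ℕ) (a : Fin d) :
    MeasurePreserving (fun x : Fin d → ℝ => x a) (stdGaussianVec d) (gaussianReal 0 (d : NNReal)⁻¹) :=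
  measurePreserving_eval (fun _ : Fin d => gaussianReal 0 (d : NNReal)⁻¹) a

lemma coord_memLp (d : ℕ) (a : Fin d) (p : NNReal) :
    MemLp (fun x : Fin d → ℝ => x a) p (stdGaussianVec d) :=
  (memLp_id_gaussianReal (μ := 0) (v := (d : NNReal)⁻¹) p).comp_measurePreserving (coord_mp d a)

/-- fourth moment of the standard Gaussian -/
def M4 : ℝ := ∫ x, x ^ 4 ∂gaussianReal 0 1

lemma M4_nonneg : 0 ≤ M4 := integral_nonneg fun x => by positivity

lemma gauss_fourth (d : ℕ) : ∫ x, x ^ 4 ∂gaussianReal 0 (d : NNReal)⁻¹ = M4 / d ^ 2 := by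
  have h := gaussianReal_map_const_mul (μ := 0) (v := 1) (Real.sqrt ((d : ℝ)⁻¹))
  have h2 : gaussianReal (Real.sqrt ((d : ℝ)⁻¹) * 0) (NNReal.mk (Real.sqrt ((d : ℝ)⁻¹) ^ 2) (sq_nonneg _) * 1)
      = gaussianReal 0 (d : NNReal)⁻¹ := by
    congr 1
    · simp
    · ext
      simp 
  rw [← h2, ← h, integral_map (by fun_prop) (by fun_prop)]
  simp_rw [mul_pow]
  rw [integral_const_mul]
  unfold M4
  rw [show Real.sqrt ((d : ℝ)⁻¹) ^ 4 = (Real.sqrt ((d : ℝ)⁻¹) ^ 2) ^ 2 by ring, Real.sq_sqrt (by positivity)]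
  field_simp

lemma gauss_second (s : NNReal) : ∫ x, x ^ 2 ∂gaussianReal 0 s = s := by
  have h := variance_fun_id_gaussianReal (μ := 0) (v := s)
  rw [variance_eq_integral (by fun_prop)] at h
  simpa [integral_id_gaussianReal] using h

lemma vec_sq_coord (d : ℕ) (a : Fin d) : ∫ x, x a ^ 2 ∂stdGaussianVec d = (d : ℝ)⁻¹ := by
  have := integral_map (μ := stdGaussianVec d) (coord_mp d a).measurable.aemeasurable
    (f := fun z : ℝ => z ^ 2) (by fun_prop)
  rw [← this, (coord_mp d a).map_eq, gauss_second]; simp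

lemma vec_four_coord (d : ℕ) (a : Fin d) : ∫ x, x a ^ 4 ∂stdGaussianVec d = M4 / d ^ 2 := by
  have := integral_map (μ := stdGaussianVec d) (coord_mp d a).measurable.aemeasurable
    (f := fun z : ℝ => z ^ 4) (by fun_prop)
  rw [← this, (coord_mp d a).map_eq, gauss_fourth]

lemma sq_coord_memLp (d : ℕ) (a : Fin d) :
    MemLp (fun x : Fin d → ℝ => x a ^ 2) 2 (stdGaussianVec d) := by
  have h := (coord_memLp d a 4)
  have : ENNReal.HolderTriple (4 : NNReal) (4 : NNReal) 2 := ⟨by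
    rw [← two_mul]
    rw [show ((4 : NNReal) : ENNReal) = 2 * 2 by norm_num, ENNReal.mul_inv (by simp) (by simp), ← mul_assoc,
      ENNReal.mul_inv_cancel (by simp) (by simp), one_mul]⟩
  have h2 := h.mul (r := 2) h
  refine h2.congr_norm (Measurable.aestronglyMeasurable (by fun_prop)) (Filter.Eventually.of_forall fun x => ?_)
  simp [pow_two]

lemma vec_norm_var (d : ℕ) (hd : 0 < d) :
    ∫ x, (x ⬝ᵥ x - 1) ^ 2 ∂stdGaussianVec d ≤ M4 / d := by
  have hd' : (0 : ℝ) < d := by exact_mod_cast hd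
  have hind : iIndepFun (fun (a : Fin d) (x : Fin d → ℝ) => x a ^ 2) (stdGaussianVec d) :=
    iIndepFun_pi (X := fun (_ : Fin d) (z : ℝ) => z ^ 2) (fun _ => by fun_prop)
  have hv := IndepFun.variance_sum (μ := stdGaussianVec d) (s := Finset.univ)
    (X := fun (a : Fin d) (x : Fin d → ℝ) => x a ^ 2)
    (fun a _ => sq_coord_memLp d a) (fun a _ b _ hab => hind.indepFun hab)
  have hmean : ∫ x, (∑ a, x a ^ 2) ∂stdGaussianVec d = 1 := by
    rw [integral_finsetSum]
    · simp_rw [vec_sq_coord]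
      simp
      field_simp
    · intro a _
      exact (sq_coord_memLp d a).integrable (by norm_num)
  have e : (∑ a : Fin d, fun x : Fin d → ℝ => x a ^ 2) = fun x => ∑ a, x a ^ 2 := by
    ext x; simp
  rw [e, variance_eq_integral (Measurable.aemeasurable (by fun_prop)), hmean] at hv
  have e2 : ∀ x : Fin d → ℝ, x ⬝ᵥ x = ∑ a, x a ^ 2 := fun x => by simp [dotProduct, pow_two]
  simp_rw [e2]
  rw [hv]
  calc _ ≤ ∑ a : Fin d, M4 / d ^ 2 := by
        apply Finset.sum_le_sum
        intro a _
        refine (variance_le_expectation_sq (Measurable.aestronglyMeasurable (by fun_prop))).trans_eq ?_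
        rw [← vec_four_coord d a]
        congr 1; ext x; simp; ring
    _ = M4 / d := by simp; field_simp

lemma vec_norm_mean (d : ℕ) (hd : 0 < d) :
    ∫ x, (x ⬝ᵥ x) ∂stdGaussianVec d = 1 := by
  have hd' : (0 : ℝ) < d := by exact_mod_cast hd
  have e2 : ∀ x : Fin d → ℝ, x ⬝ᵥ x = ∑ a, x a ^ 2 := fun x => by simp [dotProduct, pow_two]
  simp_rw [e2]
  rw [integral_finsetSum]
  · simp_rw [vec_sq_coord]
    simp
    field_simp
  · intro a _
    exact (sq_coord_memLp d a).integrable (by norm_num)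

lemma vec_dot_sq (d : ℕ) (b : Fin d → ℝ) :
    ∫ x, (x ⬝ᵥ b) ^ 2 ∂stdGaussianVec d = (b ⬝ᵥ b) / d := by
  have hm : Measurable (fun x : Fin d → ℝ => x ⬝ᵥ b) := by
    unfold dotProduct; fun_prop
  have hb : 0 ≤ b ⬝ᵥ b := by
    simp only [dotProduct]
    exact Finset.sum_nonneg fun i _ => mul_self_nonneg _
  have := integral_map (μ := stdGaussianVec d) hm.aemeasurable
    (f := fun z : ℝ => z ^ 2) (by fun_prop)
  rw [← this, vec_map_dot, gauss_second, Real.coe_toNNReal _ (by positivity)]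

/-- The law of all the `n` vectors. -/
def vecs (d n : ℕ) : Measure (Fin n → Fin d → ℝ) := Measure.pi fun _ : Fin n => stdGaussianVec d

instance (d n : ℕ) : IsProbabilityMeasure (vecs d n) := by
  unfold vecs; infer_instance

lemma vecs_eval (d n : ℕ) (l : Fin n) :
    MeasurePreserving (fun u : Fin n → Fin d → ℝ => u l) (vecs d n) (stdGaussianVec d) :=
  measurePreserving_eval (fun _ : Fin n => stdGaussianVec d) l

lemma dot_memLp (d n : ℕ) (l k : Fin n) :
    MemLp (fun u : Fin n → Fin d → ℝ => u l ⬝ᵥ u k) 2 (vecs d n) := by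
  have : ENNReal.HolderTriple (4 : NNReal) (4 : NNReal) 2 := ⟨by
    rw [← two_mul]
    rw [show ((4 : NNReal) : ENNReal) = 2 * 2 by norm_num, ENNReal.mul_inv (by simp) (by simp), ← mul_assoc,
      ENNReal.mul_inv_cancel (by simp) (by simp), one_mul]⟩
  have h1 : ∀ (l : Fin n) (a : Fin d), MemLp (fun u : Fin n → Fin d → ℝ => u l a) (4 : NNReal) (vecs d n) :=
    fun l a => (coord_memLp d a 4).comp_measurePreserving (vecs_eval d n l)
  unfold dotProduct
  refine memLp_finsetSum _ fun a _ => ?_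
  exact (h1 k a).mul (r := 2) (h1 l a)

/-- Kronecker delta -/
def kd {n : ℕ} (l k : Fin n) : ℝ := if l = k then 1 else 0

/-- Gram deviation -/
def gdev {d n : ℕ} (u : Fin n → Fin d → ℝ) (l k : Fin n) : ℝ := u l ⬝ᵥ u k - kd l k

lemma gdev_memLp (d n : ℕ) (l k : Fin n) :
    MemLp (fun u : Fin n → Fin d → ℝ => gdev u l k) 2 (vecs d n) :=
  (dot_memLp d n l k).sub (memLp_const _)

lemma gdev_sq (d n : ℕ) (hd : 0 < d) (l k : Fin n) :
    ∫ u, (gdev u l k) ^ 2 ∂vecs d n ≤ (1 + M4) / d := by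
  have hd' : (0 : ℝ) < d := by exact_mod_cast hd
  by_cases h : l = k
  · subst h
    simp only [gdev, kd, if_true]
    have := integral_map (μ := vecs d n) (vecs_eval d n l).measurable.aemeasurable
      (f := fun z : Fin d → ℝ => (z ⬝ᵥ z - 1) ^ 2) (by 
        apply Measurable.aestronglyMeasurable; unfold dotProduct; fun_prop)
    rw [← this, (vecs_eval d n l).map_eq]
    refine (vec_norm_var d hd).trans ?_
    gcongr
    linarith
  · simp only [gdev, kd, if_neg h, sub_zero]
    have hind : IndepFun (fun u : Fin n → Fin d → ℝ => u l) (fun u => u k) (vecs d n) :=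
      (iIndepFun_pi (X := fun (_ : Fin n) (z : Fin d → ℝ) => z) (fun _ => by fun_prop)).indepFun h
    have hmap := (indepFun_iff_map_prod_eq_prod_map_map (measurable_pi_apply l).aemeasurable (measurable_pi_apply k).aemeasurable).1 hind
    rw [(vecs_eval d n l).map_eq, (vecs_eval d n k).map_eq] at hmap
    have hmeas : Measurable (fun z : (Fin d → ℝ) × (Fin d → ℝ) => (z.1 ⬝ᵥ z.2) ^ 2) := by
      unfold dotProduct; fun_prop
    have := integral_map (μ := vecs d n) (φ := fun u => (u l, u k)) (by fun_prop)
      (f := fun z : (Fin d → ℝ) × (Fin d → ℝ) => (z.1 ⬝ᵥ z.2) ^ 2) hmeas.aestronglyMeasurable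
    rw [← this, hmap, integral_prod_symm]
    · simp_rw [vec_dot_sq]
      rw [integral_div, vec_norm_mean d hd]
      gcongr
      linarith [M4_nonneg]
    · rw [← hmap]
      refine (integrable_map_measure hmeas.aestronglyMeasurable (by fun_prop)).2 ?_
      exact (dot_memLp d n l k).integrable_sq



lemma split_integral {n : ℕ} {E : Type*} [MeasurableSpace E] (μ : Measure E) [IsProbabilityMeasure μ]
    (T : Finset (Fin n)) (G : (Fin n → E) → ℂ) (c : (Fin n → E) → E → ℂ) (c' : (Fin n → E) → ℂ)
    (hG : ∀ p q, (∀ k ∈ T, p k = q k) → G p = G q)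
    (hc : ∀ p q, (∀ k ∈ T, p k = q k) → c p = c q)
    (hc' : ∀ p, ∫ x, c p x ∂μ = c' p)
    (hi1 : Integrable (fun p => G p * ∏ k ∈ Tᶜ, c p (p k)) (Measure.pi fun _ : Fin n => μ))
    (hi2 : Integrable (fun p => G p * c' p ^ (Tᶜ).card) (Measure.pi fun _ : Fin n => μ)) :
    ∫ p, G p * ∏ k ∈ Tᶜ, c p (p k) ∂(Measure.pi fun _ : Fin n => μ)
      = ∫ p, G p * c' p ^ (Tᶜ).card ∂(Measure.pi fun _ : Fin n => μ) := by
  have hE : Nonempty E := μ.nonempty_of_neZero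
  obtain ⟨z⟩ := hE
  have mp := (measurePreserving_piEquivPiSubtypeProd (fun _ : Fin n => μ) (fun k => k ∈ T)).symm
  set e := (MeasurableEquiv.piEquivPiSubtypeProd (fun _ : Fin n => E) (fun k => k ∈ T)).symm with he
  have heT : ∀ (q) (k) (hk : k ∈ T), e q k = q.1 ⟨k, hk⟩ := by
    intro q k hk
    simp [he, MeasurableEquiv.piEquivPiSubtypeProd, Equiv.piEquivPiSubtypeProd, hk]
  have heN : ∀ (q) (k) (hk : k ∉ T), e q k = q.2 ⟨k, hk⟩ := by
    intro q k hk
    simp [he, MeasurableEquiv.piEquivPiSubtypeProd, Equiv.piEquivPiSubtypeProd, hk]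
  rw [← mp.integral_comp' (g := fun p => G p * ∏ k ∈ Tᶜ, c p (p k)),
    ← mp.integral_comp' (g := fun p => G p * c' p ^ (Tᶜ).card)]
  rw [integral_prod, integral_prod]
  rotate_left
  · exact (mp.integrable_comp_emb e.measurableEmbedding).2 hi2
  · exact (mp.integrable_comp_emb e.measurableEmbedding).2 hi1
  congr 1
  ext x
  have key : ∀ y k, k ∈ T → e (x, y) k = e (x, fun _ => z) k := by
    intro y k hk
    rw [heT _ _ hk, heT _ _ hk]
  have h1 : ∀ y, G (e (x, y)) = G (e (x, fun _ => z)) := fun y => hG _ _ (key y)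
  have h2 : ∀ y, c (e (x, y)) = c (e (x, fun _ => z)) := fun y => hc _ _ (key y)
  have h3 : ∀ y, c' (e (x, y)) = c' (e (x, fun _ => z)) := fun y => by
    rw [← hc', ← hc', h2 y]
  have h4 : ∀ y, ∏ k ∈ Tᶜ, c (e (x, y)) (e (x, y) k)
      = ∏ k : {k // k ∉ T}, c (e (x, fun _ => z)) (y k) := by
    intro y
    rw [h2 y]
    rw [← Finset.prod_subtype (p := fun k => k ∉ T) (F := inferInstance) Tᶜ (by simp) (fun k => c (e (x, fun _ => z)) (e (x, y) k)) |>.symm]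
    refine Finset.prod_congr rfl fun k _ => ?_
    rw [heN _ _ k.2]
  simp_rw [h4, h1, h3]
  rw [integral_const_mul]
  simp only [integral_const, probReal_univ, one_smul]
  congr 1
  rw [integral_fintype_prod_eq_prod (f := fun (_ : {k // k ∉ T}) => c (e (x, fun _ => z)))]
  simp only [hc', Finset.prod_const, Finset.card_univ]
  congr 1
  simp [Fintype.card_subtype_compl, Finset.card_compl]

lemma score_eq {d n : ℕ} (u v : Fin n → Fin d → ℝ) (l i : Fin n) :
    scoreX u v l i = ∑ k, (v k ⬝ᵥ v i) * (u k ⬝ᵥ u l) := by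
  simp only [scoreX, Wcross, dotProduct, Matrix.mulVec, Matrix.of_apply]
  simp_rw [Finset.sum_mul, Finset.mul_sum]
  rw [Finset.sum_comm' (t' := Finset.univ) (s' := fun _ => Finset.univ) (by simp)]
  conv_rhs => rw [Finset.sum_comm]
  refine Finset.sum_congr rfl fun b _ => ?_
  rw [Finset.sum_comm]
  refine Finset.sum_congr rfl fun a _ => ?_
  refine Finset.sum_congr rfl fun k _ => ?_
  ring

/-- linear combination of the `u` vectors -/
def ycomb {d n : ℕ} (T : Finset (Fin n)) (t : Fin n → ℝ) (u : Fin n → Fin d → ℝ) : Fin d → ℝ :=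
  fun a => ∑ l ∈ T, t l * u l a

lemma dot_ycomb {d n : ℕ} (T : Finset (Fin n)) (t : Fin n → ℝ) (u : Fin n → Fin d → ℝ)
    (w : Fin d → ℝ) : w ⬝ᵥ ycomb T t u = ∑ l ∈ T, t l * (w ⬝ᵥ u l) := by
  simp only [dotProduct, ycomb, Finset.mul_sum]
  rw [Finset.sum_comm]
  refine Finset.sum_congr rfl fun b _ => Finset.sum_congr rfl fun a _ => ?_
  ring

lemma score_comb {d n : ℕ} (T : Finset (Fin n)) (t : Fin n → ℝ) (u v : Fin n → Fin d → ℝ)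
    (i : Fin n) : ∑ l ∈ T, t l * scoreX u v l i
      = ∑ k, (v k ⬝ᵥ v i) * (u k ⬝ᵥ ycomb T t u) := by
  simp_rw [score_eq, dot_ycomb, Finset.mul_sum]
  rw [Finset.sum_comm]
  refine Finset.sum_congr rfl fun b _ => Finset.sum_congr rfl fun a _ => ?_
  ring

/-- the part of the exponent coming from the indices in `T` -/
def Rpart {d n : ℕ} (T : Finset (Fin n)) (t : Fin n → ℝ) (i : Fin n)
    (p : (Fin n → Fin d → ℝ) × (Fin n → Fin d → ℝ)) : ℝ :=
  ∑ k ∈ T, (p.2 k ⬝ᵥ p.2 i) * (p.1 k ⬝ᵥ ycomb T t p.1)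

def Xpart {d n : ℕ} (T : Finset (Fin n)) (t : Fin n → ℝ) (i : Fin n)
    (p : (Fin n → Fin d → ℝ) × (Fin n → Fin d → ℝ)) : ℝ :=
  (p.2 i ⬝ᵥ p.2 i) * (ycomb T t p.1 ⬝ᵥ ycomb T t p.1)

lemma meas_Rpart {d n : ℕ} (T : Finset (Fin n)) (t : Fin n → ℝ) (i : Fin n) :
    Measurable (Rpart (d := d) T t i) := by
  unfold Rpart ycomb dotProduct; fun_prop

lemma meas_Xpart {d n : ℕ} (T : Finset (Fin n)) (t : Fin n → ℝ) (i : Fin n) :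
    Measurable (Xpart (d := d) T t i) := by
  unfold Xpart ycomb dotProduct; fun_prop

lemma dot_self_nonneg' {d : ℕ} (b : Fin d → ℝ) : 0 ≤ b ⬝ᵥ b := by
  simp only [dotProduct]
  exact Finset.sum_nonneg fun i _ => mul_self_nonneg _

lemma Xpart_nonneg {d n : ℕ} (T : Finset (Fin n)) (t : Fin n → ℝ) (i : Fin n) (p) :
    0 ≤ Xpart (d := d) T t i p := mul_nonneg (dot_self_nonneg' _) (dot_self_nonneg' _)

/-- `1/√(1+x/d²)` -/
def qf (d : ℕ) (x : ℝ) : ℝ := 1 / Real.sqrt (1 + x / d ^ 2)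

lemma qf_nonneg (d : ℕ) (x : ℝ) : 0 ≤ qf d x := by unfold qf; positivity

lemma qf_le_one (d : ℕ) (x : ℝ) (hx : 0 ≤ x) : qf d x ≤ 1 := by
  unfold qf
  rw [div_le_one (by positivity)]
  rw [Real.one_le_sqrt]
  have : 0 ≤ x / d ^ 2 := by positivity
  linarith

lemma charfun_exact (d n : ℕ) (T : Finset (Fin n)) (t : Fin n → ℝ) (i : Fin n) (hi : i ∈ T) :
    ∫ p, Complex.exp (((∑ l ∈ T, t l * scoreX p.1 p.2 l i : ℝ) : ℂ) * Complex.I) ∂gaussianModel d n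
      = ∫ p, Complex.exp ((Rpart T t i p : ℂ) * Complex.I) * ((qf d (Xpart T t i p) : ℝ) : ℂ) ^ (Tᶜ).card
          ∂gaussianModel d n := by
  have mp := measurePreserving_arrowProdEquivProdArrow (Fin d → ℝ) (Fin d → ℝ) (Fin n)
    (fun _ => stdGaussianVec d) (fun _ => stdGaussianVec d)
  set e := MeasurableEquiv.arrowProdEquivProdArrow (Fin d → ℝ) (Fin d → ℝ) (Fin n) with he
  have e1 : ∀ p k, (e p).1 k = (p k).1 := fun p k => rfl
  have e2 : ∀ p k, (e p).2 k = (p k).2 := fun p k => rfl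
  unfold gaussianModel
  rw [← mp.integral_comp', ← mp.integral_comp']
  have hq1 : ∀ p, ‖((qf d (Xpart (d := d) T t i p) : ℝ) : ℂ)‖ ≤ 1 := by
    intro p
    rw [Complex.norm_real, Real.norm_of_nonneg (qf_nonneg _ _)]
    exact qf_le_one _ _ (Xpart_nonneg _ _ _ _)
  have hy : ∀ p q : Fin n → (Fin d → ℝ) × (Fin d → ℝ), (∀ k ∈ T, p k = q k) →
      ycomb T t (e p).1 = ycomb T t (e q).1 := by
    intro p q h
    ext a
    unfold ycomb
    refine Finset.sum_congr rfl fun k hk => ?_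
    rw [e1, e1, h k hk]
  have hprod : ∀ p : Fin n → (Fin d → ℝ) × (Fin d → ℝ),
      Complex.exp (((∑ l ∈ T, t l * scoreX (e p).1 (e p).2 l i : ℝ) : ℂ) * Complex.I)
      = Complex.exp ((Rpart T t i (e p) : ℂ) * Complex.I) *
        ∏ k ∈ Tᶜ, Complex.exp (((((p k).2 ⬝ᵥ (e p).2 i) * ((p k).1 ⬝ᵥ ycomb T t (e p).1) : ℝ) : ℂ) * Complex.I) := by
    intro p
    rw [score_comb, ← Complex.exp_sum, ← Complex.exp_add, ← Finset.sum_mul, ← add_mul,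
      ← Complex.ofReal_sum, ← Complex.ofReal_add]
    congr 3
    unfold Rpart
    rw [← Finset.sum_add_sum_compl T]
    rfl
  have := split_integral ((stdGaussianVec d).prod (stdGaussianVec d)) T
    (fun p => Complex.exp ((Rpart T t i (e p) : ℂ) * Complex.I))
    (fun p x => Complex.exp ((((x.2 ⬝ᵥ (e p).2 i) * (x.1 ⬝ᵥ ycomb T t (e p).1) : ℝ) : ℂ) * Complex.I))
    (fun p => ((qf d (Xpart T t i (e p)) : ℝ) : ℂ)) ?_ ?_ ?_ ?_ ?_
  · simp_rw [hprod]
    exact this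
  · intro p q h
    have : Rpart T t i (e p) = Rpart T t i (e q) := by
      unfold Rpart
      refine Finset.sum_congr rfl fun k hk => ?_
      rw [hy p q h, e1, e2, e2, e1, e2, e2, h k hk, h i hi]
    simp only [this]
  · intro p q h
    ext x
    rw [hy p q h, e2, e2, h i hi]
  · intro p
    rw [pair_charfun]
    rfl
  · apply Integrable.of_bound (C := 1)
    · apply Measurable.aestronglyMeasurable
      have := (meas_Rpart (d := d) T t i).comp e.measurable
      refine Measurable.mul (by fun_prop) (Finset.measurable_prod _ fun k _ => ?_)
      simp only [ycomb, dotProduct, e1, e2]; fun_prop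
    · refine Filter.Eventually.of_forall fun x => ?_
      simp [Complex.norm_exp_ofReal_mul_I, -Complex.ofReal_mul]
  · apply Integrable.of_bound (C := 1)
    · apply Measurable.aestronglyMeasurable
      have := (meas_Rpart (d := d) T t i).comp e.measurable
      have := (meas_Xpart (d := d) T t i).comp e.measurable
      unfold qf
      fun_prop
    · refine Filter.Eventually.of_forall fun x => ?_
      rw [norm_mul, norm_pow, Complex.norm_exp_ofReal_mul_I, one_mul]
      exact pow_le_one₀ (norm_nonneg _) (hq1 _)



lemma qf_lip (d : ℕ) (x y : ℝ) (hx : 0 ≤ x) (hy : 0 ≤ y) : |qf d x - qf d y| ≤ |x - y| / d ^ 2 := by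
  unfold qf
  have key : ∀ a b : ℝ, 0 ≤ a → 0 ≤ b → |1 / Real.sqrt (1 + a) - 1 / Real.sqrt (1 + b)| ≤ |a - b| := by
    intro a b ha hb
    set r := Real.sqrt (1 + a) with hr
    set s := Real.sqrt (1 + b) with hs
    have hr1 : 1 ≤ r := by rw [hr, Real.one_le_sqrt]; linarith
    have hs1 : 1 ≤ s := by rw [hs, Real.one_le_sqrt]; linarith
    have hr2 : r ^ 2 = 1 + a := Real.sq_sqrt (by linarith)
    have hs2 : s ^ 2 = 1 + b := Real.sq_sqrt (by linarith)
    have e : 1 / r - 1 / s = (s - r) / (r * s) := by field_simp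
    have e2 : a - b = (r - s) * (r + s) := by nlinarith
    rw [e, e2, abs_div, abs_mul (r - s), abs_sub_comm s r, abs_of_pos (show 0 < r * s by positivity),
      abs_of_pos (show 0 < r + s by positivity)]
    have h1 : |r - s| / (r * s) ≤ |r - s| := div_le_self (abs_nonneg _) (by nlinarith)
    have h2 : |r - s| ≤ |r - s| * (r + s) := le_mul_of_one_le_right (abs_nonneg _) (by linarith)
    exact h1.trans h2
  refine (key _ _ (by positivity) (by positivity)).trans_eq ?_
  rw [← sub_div, abs_div, abs_of_nonneg (show (0 : ℝ) ≤ d ^ 2 by positivity)]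

lemma pow_lip (N : ℕ) (a b : ℝ) (ha : 0 ≤ a) (ha1 : a ≤ 1) (hb : 0 ≤ b) (hb1 : b ≤ 1) :
    |a ^ N - b ^ N| ≤ N * |a - b| := by
  induction N with
  | zero => simp
  | succ k ih =>
    have e : a ^ (k + 1) - b ^ (k + 1) = a * (a ^ k - b ^ k) + (a - b) * b ^ k := by ring
    rw [e]
    refine (abs_add_le _ _).trans ?_
    rw [abs_mul, abs_mul, abs_of_nonneg ha, abs_of_nonneg (pow_nonneg hb k)]
    have h1 : a * |a ^ k - b ^ k| ≤ |a ^ k - b ^ k| := mul_le_of_le_one_left (abs_nonneg _) ha1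
    have h2 : |a - b| * b ^ k ≤ |a - b| := mul_le_of_le_one_right (abs_nonneg _) (pow_le_one₀ hb hb1)
    push_cast
    linarith

lemma cexp_lip (a b : ℝ) : ‖Complex.exp (a * Complex.I) - Complex.exp (b * Complex.I)‖ ≤ |a - b| := by
  have e : Complex.exp (a * Complex.I) - Complex.exp (b * Complex.I)
      = Complex.exp (b * Complex.I) * (Complex.exp (Complex.I * ((a - b : ℝ) : ℂ)) - 1) := by
    rw [mul_sub, ← Complex.exp_add]
    push_cast
    congr 2 <;> ring
  rw [e, norm_mul, Complex.norm_exp_ofReal_mul_I, one_mul]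
  exact Real.norm_exp_I_mul_ofReal_sub_one_le

/-- total Gram deviation on `T` -/
def Mdev {d n : ℕ} (T : Finset (Fin n)) (p : (Fin n → Fin d → ℝ) × (Fin n → Fin d → ℝ)) : ℝ :=
  ∑ a ∈ T ×ˢ T, (|gdev p.1 a.1 a.2| + |gdev p.2 a.1 a.2|)

def Wdev {d n : ℕ} (T : Finset (Fin n)) (p : (Fin n → Fin d → ℝ) × (Fin n → Fin d → ℝ)) : ℝ :=
  ∑ a ∈ T ×ˢ T, (gdev p.1 a.1 a.2 ^ 2 + gdev p.2 a.1 a.2 ^ 2)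

lemma Mdev_nonneg {d n : ℕ} (T : Finset (Fin n)) (p) : 0 ≤ Mdev (d := d) T p :=
  Finset.sum_nonneg fun _ _ => by positivity

lemma Mdev_sq {d n : ℕ} (T : Finset (Fin n)) (p) :
    Mdev (d := d) T p ^ 2 ≤ 2 * (T.card : ℝ) ^ 2 * Wdev T p := by
  unfold Mdev Wdev
  refine (sq_sum_le_card_mul_sum_sq).trans ?_
  rw [Finset.card_product, Finset.mul_sum, Finset.mul_sum]
  refine Finset.sum_le_sum fun a _ => ?_
  push_cast
  have h : (|gdev p.1 a.1 a.2| + |gdev p.2 a.1 a.2|) ^ 2 ≤ 2 * (gdev p.1 a.1 a.2 ^ 2 + gdev p.2 a.1 a.2 ^ 2) := by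
    rw [← sq_abs (gdev p.1 a.1 a.2), ← sq_abs (gdev p.2 a.1 a.2)]
    nlinarith [sq_nonneg (|gdev p.1 a.1 a.2| - |gdev p.2 a.1 a.2|)]
  nlinarith [mul_self_nonneg (T.card : ℝ)]

lemma gdev_le_M1 {d n : ℕ} (T : Finset (Fin n)) (p) (l k : Fin n) (hl : l ∈ T) (hk : k ∈ T) :
    |gdev p.1 l k| ≤ Mdev (d := d) T p := by
  have := Finset.single_le_sum (s := T ×ˢ T) (f := fun a => (|gdev p.1 a.1 a.2| + |gdev p.2 a.1 a.2|))
    (fun _ _ => by positivity) (Finset.mk_mem_product hl hk)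
  unfold Mdev
  refine le_trans ?_ this
  simp

lemma gdev_le_M2 {d n : ℕ} (T : Finset (Fin n)) (p) (l k : Fin n) (hl : l ∈ T) (hk : k ∈ T) :
    |gdev p.2 l k| ≤ Mdev (d := d) T p := by
  have := Finset.single_le_sum (s := T ×ˢ T) (f := fun a => (|gdev p.1 a.1 a.2| + |gdev p.2 a.1 a.2|))
    (fun _ _ => by positivity) (Finset.mk_mem_product hl hk)
  unfold Mdev
  refine le_trans ?_ this
  simp

lemma abs_sum_le_card {n : ℕ} (T : Finset (Fin n)) (f : Fin n → ℝ) (b : ℝ) (h : ∀ k ∈ T, |f k| ≤ b) :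
    |∑ k ∈ T, f k| ≤ T.card * b := by
  refine (Finset.abs_sum_le_sum_abs _ _).trans ?_
  refine (Finset.sum_le_card_nsmul T _ b h).trans_eq ?_
  simp

lemma uy_eq {d n : ℕ} (T : Finset (Fin n)) (t : Fin n → ℝ) (u : Fin n → Fin d → ℝ) (k : Fin n) (hk : k ∈ T) :
    u k ⬝ᵥ ycomb T t u = t k + ∑ l ∈ T, t l * gdev u k l := by
  rw [dot_ycomb]
  have : ∀ l, t l * (u k ⬝ᵥ u l) = t l * kd k l + t l * gdev u k l := by
    intro l; unfold gdev; ring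
  simp_rw [this]
  rw [Finset.sum_add_distrib]
  congr 1
  simp [kd, hk]

lemma err_le {d n : ℕ} (T : Finset (Fin n)) (t : Fin n → ℝ) (B : ℝ) (hB : ∀ l, |t l| ≤ B)
    (p) (k : Fin n) (hk : k ∈ T) :
    |∑ l ∈ T, t l * gdev p.1 k l| ≤ T.card * (B * Mdev (d := d) T p) := by
  apply abs_sum_le_card
  intro l hl
  rw [abs_mul]
  exact mul_le_mul (hB l) (gdev_le_M1 T p k l hk hl) (abs_nonneg _) ((abs_nonneg _).trans (hB l))

lemma R_le {d n : ℕ} (T : Finset (Fin n)) (t : Fin n → ℝ) (B : ℝ) (hB : ∀ l, |t l| ≤ B)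
    (i : Fin n) (hi : i ∈ T) (p) :
    |Rpart T t i p - t i| ≤ 2 * (T.card : ℝ) ^ 2 * B * (Mdev (d := d) T p + Mdev T p ^ 2) := by
  have hB0 : 0 ≤ B := (abs_nonneg _).trans (hB i)
  have hM := Mdev_nonneg (d := d) T p
  have hc : (1 : ℝ) ≤ T.card := by exact_mod_cast Finset.card_pos.2 ⟨i, hi⟩
  set e : Fin n → ℝ := fun k => ∑ l ∈ T, t l * gdev p.1 k l with he
  have h1 : Rpart T t i p - t i = e i + ∑ k ∈ T, gdev p.2 k i * (t k + e k) := by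
    unfold Rpart
    have : ∀ k ∈ T, (p.2 k ⬝ᵥ p.2 i) * (p.1 k ⬝ᵥ ycomb T t p.1)
        = kd k i * (t k + e k) + gdev p.2 k i * (t k + e k) := by
      intro k hk
      rw [uy_eq T t p.1 k hk]
      change (p.2 k ⬝ᵥ p.2 i) * (t k + e k) = _
      simp only [gdev]; ring
    rw [Finset.sum_congr rfl this, Finset.sum_add_distrib]
    have : ∑ k ∈ T, kd k i * (t k + e k) = t i + e i := by simp [kd, hi]
    rw [this]; ring
  have h2 := abs_sum_le_card T (fun k => gdev p.2 k i * (t k + e k))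
    (Mdev T p * (B + T.card * (B * Mdev T p))) (by
      intro k hk
      rw [abs_mul]
      refine mul_le_mul (gdev_le_M2 T p k i hk hi) ?_ (abs_nonneg _) hM
      exact (abs_add_le _ _).trans (add_le_add (hB k) (err_le T t B hB p k hk)))
  rw [h1]
  refine (abs_add_le _ _).trans ?_
  refine (add_le_add (err_le T t B hB p i hi) h2).trans ?_
  set M := Mdev T p
  set c : ℝ := (T.card : ℝ)
  have h3 : c * (B * M) ≤ c ^ 2 * (B * M) := by
    apply mul_le_mul_of_nonneg_right _ (by positivity); nlinarith
  have h4 : 0 ≤ c ^ 2 * B * M ^ 2 := by positivity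
  nlinarith

lemma X_le {d n : ℕ} (T : Finset (Fin n)) (t : Fin n → ℝ) (B : ℝ) (hB : ∀ l, |t l| ≤ B)
    (i : Fin n) (hi : i ∈ T) (p) :
    |Xpart T t i p - ∑ l ∈ T, t l ^ 2| ≤
      2 * (T.card : ℝ) ^ 2 * B ^ 2 * (Mdev (d := d) T p + Mdev T p ^ 2) := by
  have hB0 : 0 ≤ B := (abs_nonneg _).trans (hB i)
  have hM := Mdev_nonneg (d := d) T p
  have hc : (1 : ℝ) ≤ T.card := by exact_mod_cast Finset.card_pos.2 ⟨i, hi⟩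
  set e : Fin n → ℝ := fun k => ∑ l ∈ T, t l * gdev p.1 k l with he
  set τ := ∑ l ∈ T, t l ^ 2 with hτ
  have h1 : ycomb T t p.1 ⬝ᵥ ycomb T t p.1 = τ + ∑ k ∈ T, t k * e k := by
    rw [dot_ycomb]
    rw [hτ, ← Finset.sum_add_distrib]
    refine Finset.sum_congr rfl fun k hk => ?_
    rw [dotProduct_comm, uy_eq T t p.1 k hk]
    ring
  have h2 : |∑ k ∈ T, t k * e k| ≤ T.card * (B * (T.card * (B * Mdev T p))) := by
    apply abs_sum_le_card
    intro k hk
    rw [abs_mul]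
    exact mul_le_mul (hB k) (err_le T t B hB p k hk) (abs_nonneg _) hB0
  have h3 : |τ| ≤ T.card * B ^ 2 := by
    apply abs_sum_le_card
    intro k hk
    rw [abs_pow]
    exact pow_le_pow_left₀ (abs_nonneg _) (hB k) 2
  set f := ∑ k ∈ T, t k * e k
  have h4 : Xpart T t i p - τ = f + gdev p.2 i i * (τ + f) := by
    unfold Xpart
    rw [h1]
    simp only [gdev, kd, if_true]
    ring
  have h5 := gdev_le_M2 T p i i hi hi
  rw [h4]
  set M := Mdev T p
  set c : ℝ := (T.card : ℝ)
  have h6 : |gdev p.2 i i * (τ + f)| ≤ M * (c * B ^ 2 + c * (B * (c * (B * M)))) := by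
    rw [abs_mul]
    exact mul_le_mul h5 ((abs_add_le _ _).trans (add_le_add h3 h2)) (abs_nonneg _) hM
  refine (abs_add_le _ _).trans ((add_le_add h2 h6).trans ?_)
  have h3 : c * (B ^ 2 * M) ≤ c ^ 2 * (B ^ 2 * M) := by
    apply mul_le_mul_of_nonneg_right _ (by positivity); nlinarith
  have h4 : 0 ≤ c ^ 2 * B ^ 2 * M ^ 2 := by positivity
  nlinarith

lemma gdev1_int (d n : ℕ) (hd : 0 < d) (l k : Fin n) :
    Integrable (fun p : (Fin n → Fin d → ℝ) × (Fin n → Fin d → ℝ) => gdev p.1 l k ^ 2) (gaussianModel d n) ∧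
    ∫ p, gdev p.1 l k ^ 2 ∂gaussianModel d n ≤ (1 + M4) / d := by
  have mp : MeasurePreserving Prod.fst (gaussianModel d n) (vecs d n) := measurePreserving_fst
  have hI := (gdev_memLp d n l k).integrable_sq
  refine ⟨mp.integrable_comp_of_integrable hI, ?_⟩
  have := integral_map (μ := gaussianModel d n) mp.measurable.aemeasurable
    (f := fun u => gdev u l k ^ 2) (by rw [mp.map_eq]; exact hI.1)
  rw [← this, mp.map_eq]
  exact gdev_sq d n hd l k

lemma gdev2_int (d n : ℕ) (hd : 0 < d) (l k : Fin n) :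
    Integrable (fun p : (Fin n → Fin d → ℝ) × (Fin n → Fin d → ℝ) => gdev p.2 l k ^ 2) (gaussianModel d n) ∧
    ∫ p, gdev p.2 l k ^ 2 ∂gaussianModel d n ≤ (1 + M4) / d := by
  have mp : MeasurePreserving Prod.snd (gaussianModel d n) (vecs d n) := measurePreserving_snd
  have hI := (gdev_memLp d n l k).integrable_sq
  refine ⟨mp.integrable_comp_of_integrable hI, ?_⟩
  have := integral_map (μ := gaussianModel d n) mp.measurable.aemeasurable
    (f := fun u => gdev u l k ^ 2) (by rw [mp.map_eq]; exact hI.1)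
  rw [← this, mp.map_eq]
  exact gdev_sq d n hd l k

lemma Wdev_int (d n : ℕ) (hd : 0 < d) (T : Finset (Fin n)) :
    Integrable (Wdev (d := d) T) (gaussianModel d n) ∧
    ∫ p, Wdev T p ∂gaussianModel d n ≤ 2 * (T.card : ℝ) ^ 2 * ((1 + M4) / d) := by
  unfold Wdev
  have h : ∀ a ∈ T ×ˢ T, Integrable (fun p : (Fin n → Fin d → ℝ) × (Fin n → Fin d → ℝ) =>
      gdev p.1 a.1 a.2 ^ 2 + gdev p.2 a.1 a.2 ^ 2) (gaussianModel d n) :=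
    fun a _ => (gdev1_int d n hd a.1 a.2).1.add (gdev2_int d n hd a.1 a.2).1
  refine ⟨integrable_finsetSum _ h, ?_⟩
  rw [integral_finsetSum _ h]
  refine (Finset.sum_le_card_nsmul _ _ (2 * ((1 + M4) / d)) ?_).trans_eq ?_
  · intro a _
    rw [integral_add (gdev1_int d n hd a.1 a.2).1 (gdev2_int d n hd a.1 a.2).1]
    linarith [(gdev1_int d n hd a.1 a.2).2, (gdev2_int d n hd a.1 a.2).2]
  · simp [Finset.card_product]; ring

lemma charfun_est (d n : ℕ) (hd : 0 < d) (T : Finset (Fin n)) (t : Fin n → ℝ) (i : Fin n) (hi : i ∈ T)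
    (B : ℝ) (hB : ∀ l, |t l| ≤ B) :
    ‖∫ p, Complex.exp (((∑ l ∈ T, t l * scoreX p.1 p.2 l i : ℝ) : ℂ) * Complex.I) ∂gaussianModel d n
      - Complex.exp ((t i : ℂ) * Complex.I) * ((qf d (∑ l ∈ T, t l ^ 2) : ℝ) : ℂ) ^ (Tᶜ).card‖
      ≤ (2 * (T.card : ℝ) ^ 2 * B + (Tᶜ).card / d ^ 2 * (2 * (T.card : ℝ) ^ 2 * B ^ 2)) *
        (1 / Real.sqrt d + (Real.sqrt d + 1) * (4 * (T.card : ℝ) ^ 4 * ((1 + M4) / d))) := by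
  have hB0 : 0 ≤ B := (abs_nonneg _).trans (hB i)
  have hd' : (0 : ℝ) < d := by exact_mod_cast hd
  rw [charfun_exact d n T t i hi]
  set τ := ∑ l ∈ T, t l ^ 2 with hτ
  have hτ0 : 0 ≤ τ := Finset.sum_nonneg fun _ _ => by positivity
  have hRle := R_le (d := d) T t B hB i hi
  have hXle := X_le (d := d) T t B hB i hi
  have hMsq := Mdev_sq (d := d) T
  obtain ⟨hWi, hW⟩ := Wdev_int d n hd T
  rw [← hτ] at hXle
  set N := (Tᶜ).card
  set c : ℝ := (T.card : ℝ)
  clear_value N c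
  set z := Complex.exp ((t i : ℂ) * Complex.I) * ((qf d τ : ℝ) : ℂ) ^ N with hzdef
  have hIntg : Integrable (fun p => Complex.exp ((Rpart T t i p : ℂ) * Complex.I) * ((qf d (Xpart T t i p) : ℝ) : ℂ) ^ N)
      (gaussianModel d n) := by
    apply Integrable.of_bound (C := 1)
    · apply Measurable.aestronglyMeasurable
      have := (meas_Rpart (d := d) T t i)
      have := (meas_Xpart (d := d) T t i)
      unfold qf
      fun_prop
    · refine Filter.Eventually.of_forall fun x => ?_
      rw [norm_mul, norm_pow, Complex.norm_exp_ofReal_mul_I, one_mul]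
      refine pow_le_one₀ (norm_nonneg _) ?_
      rw [Complex.norm_real, Real.norm_of_nonneg (qf_nonneg _ _)]
      exact qf_le_one _ _ (Xpart_nonneg _ _ _ _)
  have hz : z = ∫ p, z ∂gaussianModel d n := by simp
  rw [hz, ← integral_sub hIntg (integrable_const _)]
  set K := 2 * c ^ 2 * B + N / d ^ 2 * (2 * c ^ 2 * B ^ 2) with hK
  have hK0 : 0 ≤ K := by positivity
  have hpt : ∀ p, ‖Complex.exp ((Rpart T t i p : ℂ) * Complex.I) * ((qf d (Xpart T t i p) : ℝ) : ℂ) ^ N - z‖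
      ≤ K * (1 / Real.sqrt d + (Real.sqrt d + 1) * (2 * c ^ 2 * Wdev (d := d) T p)) := by
    intro p
    have hX := Xpart_nonneg T t i p
    have e : Complex.exp ((Rpart T t i p : ℂ) * Complex.I) * ((qf d (Xpart T t i p) : ℝ) : ℂ) ^ N - z
        = (Complex.exp ((Rpart T t i p : ℂ) * Complex.I) - Complex.exp ((t i : ℂ) * Complex.I))
            * ((qf d (Xpart T t i p) : ℝ) : ℂ) ^ N
          + Complex.exp ((t i : ℂ) * Complex.I) *
            ((qf d (Xpart T t i p) ^ N - qf d τ ^ N : ℝ) : ℂ) := by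
      rw [hzdef]; push_cast; ring
    have h1 : ‖Complex.exp ((Rpart T t i p : ℂ) * Complex.I) * ((qf d (Xpart T t i p) : ℝ) : ℂ) ^ N - z‖
        ≤ |Rpart T t i p - t i| + N * (|Xpart T t i p - τ| / d ^ 2) := by
      rw [e]
      refine (norm_add_le _ _).trans (add_le_add ?_ ?_)
      · rw [norm_mul]
        refine (mul_le_of_le_one_right (norm_nonneg _) ?_).trans (cexp_lip _ _)
        rw [norm_pow]
        refine pow_le_one₀ (norm_nonneg _) ?_
        rw [Complex.norm_real, Real.norm_of_nonneg (qf_nonneg _ _)]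
        exact qf_le_one _ _ (Xpart_nonneg _ _ _ _)
      · rw [norm_mul, Complex.norm_exp_ofReal_mul_I, one_mul, Complex.norm_real, Real.norm_eq_abs]
        refine (pow_lip N _ _ (qf_nonneg _ _) (qf_le_one _ _ hX) (qf_nonneg _ _) (qf_le_one _ _ hτ0)).trans ?_
        exact mul_le_mul_of_nonneg_left (qf_lip d _ _ hX hτ0) (by positivity)
    have hMd := hMsq p
    have hM0 := Mdev_nonneg T p
    set M := Mdev T p
    have h2 : ‖Complex.exp ((Rpart T t i p : ℂ) * Complex.I) * ((qf d (Xpart T t i p) : ℝ) : ℂ) ^ N - z‖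
        ≤ K * (M + M ^ 2) := by
      refine h1.trans ?_
      calc _ ≤ 2 * c ^ 2 * B * (M + M ^ 2) + N * ((2 * c ^ 2 * B ^ 2 * (M + M ^ 2)) / d ^ 2) := by
            gcongr
            · exact hRle p
            · exact hXle p
        _ = K * (M + M ^ 2) := by rw [hK]; ring
    refine h2.trans (mul_le_mul_of_nonneg_left ?_ hK0)
    set r := Real.sqrt d
    have hr : 0 < r := Real.sqrt_pos.2 hd'
    have h3 : M ≤ 1 / r + r * M ^ 2 := by
      rw [div_add' _ _ _ hr.ne', le_div_iff₀ hr]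
      nlinarith [sq_nonneg (r * M - 1)]
    have h4 : (r + 1) * M ^ 2 ≤ (r + 1) * (2 * c ^ 2 * Wdev T p) :=
      mul_le_mul_of_nonneg_left hMd (by positivity)
    linarith
  refine (norm_integral_le_of_norm_le (g := fun p => K * (1 / Real.sqrt d + (Real.sqrt d + 1) * (2 * c ^ 2 * Wdev (d := d) T p)))
    ?_ (Filter.Eventually.of_forall hpt)).trans ?_
  · exact ((integrable_const _).add ((hWi.const_mul _).const_mul _)).const_mul _
  · rw [integral_const_mul, integral_add (integrable_const _) ((hWi.const_mul _).const_mul _),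
      integral_const_mul, integral_const_mul]
    simp only [integral_const, probReal_univ, one_smul]
    refine mul_le_mul_of_nonneg_left ?_ hK0
    have : 2 * c ^ 2 * ∫ p, Wdev T p ∂gaussianModel d n ≤ 4 * c ^ 4 * ((1 + M4) / d) := by
      calc _ ≤ 2 * c ^ 2 * (2 * c ^ 2 * ((1 + M4) / d)) := mul_le_mul_of_nonneg_left hW (by positivity)
        _ = _ := by ring
    gcongr



lemma q_lim (α τ : ℝ) (hτ : 0 ≤ τ) (N d : ℕ → ℕ) (hd : Tendsto d atTop atTop) (hd0 : ∀ m, 0 < d m)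
    (hlim : Tendsto (fun m => (N m : ℝ) / (d m : ℝ) ^ 2) atTop (𝓝 α)) :
    Tendsto (fun m => qf (d m) τ ^ N m) atTop (𝓝 (Real.exp (-(α * τ / 2)))) := by
  have h1 : ∀ m, qf (d m) τ ^ N m
      = Real.exp (-(((N m : ℝ) / (d m : ℝ) ^ 2) * ((d m : ℝ) ^ 2 * Real.log (1 + τ / (d m : ℝ) ^ 2)) / 2)) := by
    intro m
    have hdm : (0 : ℝ) < d m := by exact_mod_cast hd0 m
    have hp : 0 < 1 + τ / (d m : ℝ) ^ 2 := by positivity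
    have hq : qf (d m) τ = Real.exp (-(Real.log (1 + τ / (d m : ℝ) ^ 2) / 2)) := by
      unfold qf
      rw [Real.exp_neg, ← Real.log_sqrt hp.le, Real.exp_log (Real.sqrt_pos.2 hp), one_div]
    rw [hq, ← Real.exp_nat_mul]
    congr 1
    field_simp
  simp_rw [h1]
  have h2 : Tendsto (fun m => (d m : ℝ) ^ 2) atTop atTop :=
    (tendsto_pow_atTop (by norm_num)).comp (tendsto_natCast_atTop_atTop.comp hd)
  have h3 := (Real.tendsto_mul_log_one_add_div_atTop τ).comp h2
  exact (Real.continuous_exp.tendsto _).comp (((hlim.mul h3).div_const 2).neg)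

lemma charfun_lim (α : ℝ) (n d : ℕ → ℕ) (hd : Tendsto d atTop atTop) (hd0 : ∀ m, 0 < d m)
    (hlim : Tendsto (fun m => (n m : ℝ) / (d m : ℝ) ^ 2) atTop (𝓝 α))
    (I J K : ∀ m, Fin (n m)) (hIJ : ∀ m, I m ≠ J m) (hIK : ∀ m, I m ≠ K m) (hJK : ∀ m, J m ≠ K m)
    (t0 t1 t2 : ℝ) :
    Tendsto (fun m => ∫ p, Complex.exp (((t0 * scoreX p.1 p.2 (I m) (I m) + t1 * scoreX p.1 p.2 (J m) (I m)
      + t2 * scoreX p.1 p.2 (K m) (I m) : ℝ) : ℂ) * Complex.I) ∂gaussianModel (d m) (n m)) atTop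
      (𝓝 (Complex.exp ((t0 : ℂ) * Complex.I) * ((Real.exp (-(α * (t0 ^ 2 + t1 ^ 2 + t2 ^ 2) / 2)) : ℝ) : ℂ))) := by
  set T : ∀ m, Finset (Fin (n m)) := fun m => {I m, J m, K m} with hT
  set t : ∀ m, Fin (n m) → ℝ := fun m l => if l = I m then t0 else if l = J m then t1 else t2 with ht
  have hsum : ∀ m (f : Fin (n m) → ℝ), ∑ l ∈ T m, f l = f (I m) + f (J m) + f (K m) := by
    intro m f
    simp only [hT]
    rw [Finset.sum_insert, Finset.sum_insert, Finset.sum_singleton, add_assoc]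
    · simp [hJK]
    · simp [hIJ, hIK]
  have htI : ∀ m, t m (I m) = t0 := fun m => by simp [ht]
  have htJ : ∀ m, t m (J m) = t1 := fun m => by simp [ht, (hIJ m).symm]
  have htK : ∀ m, t m (K m) = t2 := fun m => by simp [ht, (hIK m).symm, (hJK m).symm]
  have hcard : ∀ m, (T m).card = 3 := by
    intro m
    simp only [hT]
    rw [Finset.card_insert_of_notMem, Finset.card_insert_of_notMem, Finset.card_singleton]
    · simp [hJK]
    · simp [hIJ, hIK]
  have hcardc : ∀ m, (((T m)ᶜ).card : ℝ) = (n m : ℝ) - 3 := by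
    intro m
    have h3 := hcard m
    have := Finset.card_add_card_compl (T m)
    rw [h3, Fintype.card_fin] at this
    have h4 : ((3 + ((T m)ᶜ).card : ℕ) : ℝ) = (n m : ℝ) := by exact_mod_cast this
    push_cast at h4
    linarith
  set B := |t0| + |t1| + |t2| with hBdef
  have hB : ∀ m l, |t m l| ≤ B := by
    intro m l
    simp only [ht]
    split_ifs <;> simp only [hBdef] <;> linarith [abs_nonneg t0, abs_nonneg t1, abs_nonneg t2]
  have hest := fun m => charfun_est (d m) (n m) (hd0 m) (T m) (t m) (I m) (by simp [hT]) B (hB m)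
  simp only [hsum, htI, htJ, htK, hcard] at hest
  have hdr : Tendsto (fun m => (d m : ℝ)) atTop atTop := tendsto_natCast_atTop_atTop.comp hd
  have hinv : Tendsto (fun m => (d m : ℝ)⁻¹) atTop (𝓝 0) := tendsto_inv_atTop_zero.comp hdr
  have hinv2 : Tendsto (fun m => 1 / Real.sqrt (d m : ℝ)) atTop (𝓝 0) := by
    simp_rw [one_div]
    exact tendsto_inv_atTop_zero.comp (Real.tendsto_sqrt_atTop.comp hdr)
  have hNlim : Tendsto (fun m => (((T m)ᶜ).card : ℝ) / (d m : ℝ) ^ 2) atTop (𝓝 α) := by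
    have : ∀ m, (((T m)ᶜ).card : ℝ) / (d m : ℝ) ^ 2 = (n m : ℝ) / (d m : ℝ) ^ 2 - 3 * ((d m : ℝ)⁻¹ * (d m : ℝ)⁻¹) := by
      intro m
      rw [hcardc, sub_div]
      congr 1
      rw [div_eq_mul_inv, pow_two, mul_inv]
    simp_rw [this]
    simpa using hlim.sub ((hinv.mul hinv).const_mul 3)
  have hq := q_lim α (t0 ^ 2 + t1 ^ 2 + t2 ^ 2) (by positivity) _ d hd hd0 hNlim
  have herr : Tendsto (fun m => (2 * ((3 : ℕ) : ℝ) ^ 2 * B + ((T m)ᶜ).card / (d m : ℝ) ^ 2 * (2 * ((3 : ℕ) : ℝ) ^ 2 * B ^ 2)) *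
        (1 / Real.sqrt (d m) + (Real.sqrt (d m) + 1) * (4 * ((3 : ℕ) : ℝ) ^ 4 * ((1 + M4) / (d m))))) atTop (𝓝 0) := by
    have e : ∀ m, (Real.sqrt (d m) + 1) * (4 * ((3 : ℕ) : ℝ) ^ 4 * ((1 + M4) / (d m)))
        = (4 * ((3 : ℕ) : ℝ) ^ 4 * (1 + M4)) * (1 / Real.sqrt (d m) + (d m : ℝ)⁻¹) := by
      intro m
      have hdm : (0 : ℝ) < d m := by exact_mod_cast hd0 m
      have : Real.sqrt (d m) / d m = 1 / Real.sqrt (d m) := by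
        rw [Real.sqrt_div_self']
      rw [← this]
      field_simp
    simp_rw [e]
    have := ((hNlim.mul_const (2 * ((3 : ℕ) : ℝ) ^ 2 * B ^ 2)).const_add (2 * ((3 : ℕ) : ℝ) ^ 2 * B)).mul
      (hinv2.add ((hinv2.add hinv).const_mul (4 * ((3 : ℕ) : ℝ) ^ 4 * (1 + M4))))
    simpa using this
  have h0 := squeeze_zero_norm hest herr
  have hq' : Tendsto (fun m => Complex.exp ((t0 : ℂ) * Complex.I) * ((qf (d m) (t0 ^ 2 + t1 ^ 2 + t2 ^ 2) : ℝ) : ℂ) ^ ((T m)ᶜ).card)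
      atTop (𝓝 (Complex.exp ((t0 : ℂ) * Complex.I) * ((Real.exp (-(α * (t0 ^ 2 + t1 ^ 2 + t2 ^ 2) / 2)) : ℝ) : ℂ))) := by
    refine Tendsto.const_mul _ ?_
    have := (Complex.continuous_ofReal.tendsto _).comp hq
    refine this.congr fun m => ?_
    simp
  have := h0.add hq'
  simpa using this

/-- limit law of three scores -/
def nu3 (s : NNReal) : Measure (EuclideanSpace ℝ (Fin 3)) :=
  (Measure.pi fun k : Fin 3 => gaussianReal (if k = 0 then 1 else 0) s).map (WithLp.toLp 2)

instance (s : NNReal) : IsProbabilityMeasure (nu3 s) := by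
  unfold nu3
  exact Measure.isProbabilityMeasure_map (by fun_prop)

lemma nu3_charFun (s : NNReal) (t : EuclideanSpace ℝ (Fin 3)) :
    charFun (nu3 s) t = Complex.exp ((t 0 : ℂ) * Complex.I) *
      ((Real.exp (-(s * (t 0 ^ 2 + t 1 ^ 2 + t 2 ^ 2) / 2)) : ℝ) : ℂ) := by
  unfold nu3
  rw [charFun_pi]
  simp only [charFun_gaussianReal, Fin.prod_univ_three]
  push_cast
  rw [← Complex.exp_add, ← Complex.exp_add, ← Complex.exp_add]
  congr 1
  simp
  ring

lemma nu3_null (s : NNReal) (hs : s ≠ 0) (k : Fin 3) (hk : k ≠ 0) :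
    nu3 s {x | x k = x 0} = 0 := by
  set P := Measure.pi fun k : Fin 3 => gaussianReal (if k = 0 then 1 else 0) s with hP
  have hset : MeasurableSet {x : EuclideanSpace ℝ (Fin 3) | x k = x 0} :=
    measurableSet_eq_fun (by fun_prop) (by fun_prop)
  unfold nu3
  rw [Measure.map_apply (by fun_prop) hset]
  have hind : IndepFun (fun x : Fin 3 → ℝ => x k) (fun x => -x 0) P :=
    ((iIndepFun_pi (μ := fun k : Fin 3 => gaussianReal (if k = 0 then 1 else 0) s)
      (X := fun (_ : Fin 3) (z : ℝ) => z) (fun _ => by fun_prop)).indepFun hk).comp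
      (φ := id) (ψ := fun z => -z) measurable_id (by fun_prop)
  have hev : ∀ k, P.map (fun x => x k) = gaussianReal (if k = 0 then 1 else 0) s := fun k =>
    (measurePreserving_eval (fun k : Fin 3 => gaussianReal (if k = 0 then 1 else 0) s) k).map_eq
  have hneg : P.map (fun x => - x 0) = gaussianReal (-1) s := by
    have : (P.map (fun x => x 0)).map (fun z : ℝ => -z) = P.map (fun x => - x 0) :=
      Measure.map_map (by fun_prop) (by fun_prop)
    rw [← this, hev, gaussianReal_map_neg]; simp
  have hadd := gaussianReal_add_gaussianReal_of_indepFun hind (hev k) hneg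
  have hss : s + s ≠ 0 := by simpa using hs
  have hnull := nullSingletonClass_gaussianReal (μ := (if k = 0 then 1 else 0) + -1) hss
  have h0 : gaussianReal ((if k = 0 then 1 else 0) + -1) (s + s) {0} = 0 := measure_singleton _
  rw [← hadd, Measure.map_apply (by fun_prop) (measurableSet_singleton _)] at h0
  refine measure_mono_null ?_ h0
  intro x hx
  simp only [Set.mem_preimage, Set.mem_ofPred_eq] at hx
  simp [hx]

def Cset : Set (EuclideanSpace ℝ (Fin 3)) := {x | x 1 ≤ x 0} ∩ {x | x 2 ≤ x 0}

lemma Cset_null (s : NNReal) (hs : s ≠ 0) : nu3 s (frontier Cset) = 0 := by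
  have h1 : frontier {x : EuclideanSpace ℝ (Fin 3) | x 1 ≤ x 0} ⊆ {x | x 1 = x 0} :=
    frontier_le_subset_eq (by fun_prop) (by fun_prop)
  have h2 : frontier {x : EuclideanSpace ℝ (Fin 3) | x 2 ≤ x 0} ⊆ {x | x 2 = x 0} :=
    frontier_le_subset_eq (by fun_prop) (by fun_prop)
  refine measure_mono_null ((frontier_inter_subset _ _).trans
    (Set.union_subset_union (Set.inter_subset_left.trans h1) (Set.inter_subset_right.trans h2))) ?_
  exact measure_union_null (nu3_null s hs 1 (by simp)) (nu3_null s hs 2 (by simp))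

lemma three_lim (s : NNReal) (hs : s ≠ 0) {Ω : ℕ → Type*} [∀ m, MeasurableSpace (Ω m)]
    (P : ∀ m, Measure (Ω m)) [∀ m, IsProbabilityMeasure (P m)]
    (X Y Z : ∀ m, Ω m → ℝ) (hX : ∀ m, Measurable (X m)) (hY : ∀ m, Measurable (Y m))
    (hZ : ∀ m, Measurable (Z m))
    (hcf : ∀ t0 t1 t2 : ℝ, Tendsto (fun m => ∫ ω, Complex.exp (((t0 * X m ω + t1 * Y m ω + t2 * Z m ω : ℝ) : ℂ)
      * Complex.I) ∂P m) atTop (𝓝 (Complex.exp ((t0 : ℂ) * Complex.I) *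
        ((Real.exp (-(s * (t0 ^ 2 + t1 ^ 2 + t2 ^ 2) / 2)) : ℝ) : ℂ)))) :
    Tendsto (fun m => (P m).real {ω | Y m ω ≤ X m ω ∧ Z m ω ≤ X m ω}) atTop (𝓝 ((nu3 s).real Cset)) := by
  set V : ∀ m, Ω m → EuclideanSpace ℝ (Fin 3) := fun m ω => !₂[X m ω, Y m ω, Z m ω] with hV
  have hVm : ∀ m, Measurable (V m) := by
    intro m
    have : Measurable (fun ω => (![X m ω, Y m ω, Z m ω] : Fin 3 → ℝ)) := by
      rw [measurable_pi_iff]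
      intro k
      fin_cases k
      · exact hX m
      · exact hY m
      · exact hZ m
    exact (by fun_prop : Measurable (WithLp.toLp 2 : (Fin 3 → ℝ) → EuclideanSpace ℝ (Fin 3))).comp this
  have hpm : ∀ m, IsProbabilityMeasure ((P m).map (V m)) := fun m =>
    Measure.isProbabilityMeasure_map (hVm m).aemeasurable
  let μs : ℕ → ProbabilityMeasure (EuclideanSpace ℝ (Fin 3)) := fun m => ⟨(P m).map (V m), hpm m⟩
  let μ0 : ProbabilityMeasure (EuclideanSpace ℝ (Fin 3)) := ⟨nu3 s, inferInstance⟩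
  have hconv : Tendsto μs atTop (𝓝 μ0) := by
    rw [ProbabilityMeasure.tendsto_iff_tendsto_charFun]
    intro t
    change Tendsto (fun m => charFun ((P m).map (V m)) t) atTop (𝓝 (charFun (nu3 s) t))
    rw [nu3_charFun]
    refine (hcf (t 0) (t 1) (t 2)).congr fun m => ?_
    rw [charFun_apply, integral_map (hVm m).aemeasurable (by fun_prop)]
    congr 1
    ext ω
    congr 3
    simp [hV, PiLp.inner_apply, Fin.sum_univ_three]
  have := ProbabilityMeasure.tendsto_measure_of_null_frontier_of_tendsto' hconv (Cset_null s hs)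
  have hC : MeasurableSet Cset :=
    (measurableSet_le (by fun_prop) (by fun_prop)).inter (measurableSet_le (by fun_prop) (by fun_prop))
  have h2 := (ENNReal.tendsto_toReal (measure_ne_top _ _)).comp this
  refine h2.congr fun m => ?_
  simp only [Function.comp, μs, ProbabilityMeasure.coe_mk, Measure.real]
  rw [Measure.map_apply (hVm m) hC]
  rfl

lemma one_lim (s : NNReal) {Ω : ℕ → Type*} [∀ m, MeasurableSpace (Ω m)]
    (P : ∀ m, Measure (Ω m)) [∀ m, IsProbabilityMeasure (P m)]
    (X : ∀ m, Ω m → ℝ) (hX : ∀ m, Measurable (X m))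
    (hcf : ∀ t0 : ℝ, Tendsto (fun m => ∫ ω, Complex.exp (((t0 * X m ω : ℝ) : ℂ)
      * Complex.I) ∂P m) atTop (𝓝 (Complex.exp ((t0 : ℂ) * Complex.I) *
        ((Real.exp (-(s * (t0 ^ 2) / 2)) : ℝ) : ℂ))))
    (g : BoundedContinuousFunction ℝ ℝ) :
    Tendsto (fun m => ∫ ω, g (X m ω) ∂P m) atTop (𝓝 (∫ x, g x ∂gaussianReal 1 s)) := by
  have hpm : ∀ m, IsProbabilityMeasure ((P m).map (X m)) := fun m =>
    Measure.isProbabilityMeasure_map (hX m).aemeasurable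
  let μs : ℕ → ProbabilityMeasure ℝ := fun m => ⟨(P m).map (X m), hpm m⟩
  let μ0 : ProbabilityMeasure ℝ := ⟨gaussianReal 1 s, inferInstance⟩
  have hconv : Tendsto μs atTop (𝓝 μ0) := by
    rw [ProbabilityMeasure.tendsto_iff_tendsto_charFun]
    intro t
    change Tendsto (fun m => charFun ((P m).map (X m)) t) atTop (𝓝 (charFun (gaussianReal 1 s) t))
    rw [charFun_gaussianReal]
    have e : Complex.exp ((t : ℂ) * ((1 : ℝ) : ℂ) * Complex.I - s * (t : ℂ) ^ 2 / 2) =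
        Complex.exp ((t : ℂ) * Complex.I) * ((Real.exp (-(s * (t ^ 2) / 2)) : ℝ) : ℂ) := by
      push_cast
      rw [← Complex.exp_add]
      congr 1
      simp
      ring
    have e' := (hcf t).congr (f₂ := fun m => charFun ((P m).map (X m)) t) fun m => by
      rw [charFun_apply_real, integral_map (hX m).aemeasurable (by fun_prop)]
      simp
    rw [← e] at e'
    exact e'
  have := ProbabilityMeasure.tendsto_iff_forall_integral_tendsto.1 hconv g
  refine this.congr fun m => ?_
  simp only [μs, ProbabilityMeasure.coe_mk]
  rw [integral_map (hX m).aemeasurable g.continuous.aestronglyMeasurable]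



/-- indicator of `a ≤ b` -/
def indLe (a b : ℝ) : ℝ := if a ≤ b then 1 else 0

lemma indLe_nonneg (a b : ℝ) : 0 ≤ indLe a b := by unfold indLe; split_ifs <;> norm_num
lemma indLe_le_one (a b : ℝ) : indLe a b ≤ 1 := by unfold indLe; split_ifs <;> norm_num

lemma indLe_measurable {Ω : Type*} [MeasurableSpace Ω] {X Y : Ω → ℝ} (hX : Measurable X) (hY : Measurable Y) :
    Measurable (fun ω => indLe (X ω) (Y ω)) := by
  unfold indLe
  exact Measurable.ite (measurableSet_le hX hY) measurable_const measurable_const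

/-- cdf of the centered Gaussian with variance `s` -/
def Fs (s : NNReal) (x : ℝ) : ℝ := (gaussianReal 0 s).real (Set.Iic x)

lemma Fs_nonneg (s : NNReal) (x : ℝ) : 0 ≤ Fs s x := measureReal_nonneg
lemma Fs_le_one (s : NNReal) (x : ℝ) : Fs s x ≤ 1 := measureReal_le_one

lemma Fs_eq (s : NNReal) (x : ℝ) : ∫ y, indLe y x ∂gaussianReal 0 s = Fs s x := by
  unfold Fs
  rw [← integral_indicator_one measurableSet_Iic]
  congr 1

lemma Fs_continuous (s : NNReal) (hs : s ≠ 0) : Continuous (Fs s) := by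
  have : Fs s = fun x => ∫ y, indLe y x ∂gaussianReal 0 s := by
    funext x; rw [Fs_eq]
  rw [this, continuous_iff_continuousAt]
  intro x
  have hnull := nullSingletonClass_gaussianReal (μ := 0) hs
  refine continuousAt_of_dominated (bound := fun _ => 1) ?_ ?_ (integrable_const _) ?_
  · exact Eventually.of_forall fun z => (indLe_measurable measurable_id measurable_const).aestronglyMeasurable
  · refine Eventually.of_forall fun z => Eventually.of_forall fun y => ?_
    rw [Real.norm_eq_abs, abs_of_nonneg (indLe_nonneg _ _)]
    exact indLe_le_one _ _
  · have h0 : gaussianReal 0 s {x} = 0 := measure_singleton _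
    have : ∀ᵐ y ∂gaussianReal 0 s, y ≠ x := by
      rw [ae_iff]; simp
    filter_upwards [this] with y hy
    rcases lt_or_gt_of_ne hy with h | h
    · refine (continuousAt_const (y := (1 : ℝ))).congr ?_
      filter_upwards [lt_mem_nhds h] with z hz
      simp [indLe, le_of_lt hz]
    · refine (continuousAt_const (y := (0 : ℝ))).congr ?_
      filter_upwards [gt_mem_nhds h] with z hz
      simp [indLe, hz]

lemma real_eq_integral {Ω : Type*} [MeasurableSpace Ω] (P : Measure Ω) [IsProbabilityMeasure P]
    (X Y Z : Ω → ℝ) (hX : Measurable X) (hY : Measurable Y) (hZ : Measurable Z) :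
    P.real {ω | Y ω ≤ X ω ∧ Z ω ≤ X ω} = ∫ ω, indLe (Y ω) (X ω) * indLe (Z ω) (X ω) ∂P := by
  have hm : MeasurableSet {ω | Y ω ≤ X ω ∧ Z ω ≤ X ω} :=
    (measurableSet_le hY hX).inter (measurableSet_le hZ hX)
  rw [← integral_indicator_one hm]
  congr 1
  ext ω
  by_cases h1 : Y ω ≤ X ω <;> by_cases h2 : Z ω ≤ X ω <;> simp [indLe, h1, h2, Set.indicator]

lemma bdd_int {Ω : Type*} [MeasurableSpace Ω] (P : Measure Ω) [IsProbabilityMeasure P]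
    {f : Ω → ℝ} (hf : Measurable f) (C : ℝ) (h : ∀ ω, |f ω| ≤ C) : Integrable f P :=
  Integrable.of_bound hf.aestronglyMeasurable C (Eventually.of_forall h)

lemma mul_bd {a b : ℝ} (ha : 0 ≤ a) (ha1 : a ≤ 1) (hb : 0 ≤ b) (hb1 : b ≤ 1) : |a * b| ≤ 1 := by
  rw [abs_of_nonneg (mul_nonneg ha hb)]; exact mul_le_one₀ ha1 hb hb1

lemma gauss_cf (s : NNReal) (t : ℝ) :
    ∫ y, Complex.exp (((t * y : ℝ) : ℂ) * Complex.I) ∂gaussianReal 0 s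
      = ((Real.exp (-(s * t ^ 2 / 2)) : ℝ) : ℂ) := by
  have := charFun_gaussianReal (μ := 0) (v := s) t
  rw [charFun_apply_real] at this
  push_cast
  rw [this]
  congr 1
  push_cast
  ring

lemma H_lim (s : NNReal) (hs : s ≠ 0) {Ω : ℕ → Type*} [∀ m, MeasurableSpace (Ω m)]
    (P : ∀ m, Measure (Ω m)) [∀ m, IsProbabilityMeasure (P m)]
    (X Y Z : ∀ m, Ω m → ℝ) (hX : ∀ m, Measurable (X m)) (hY : ∀ m, Measurable (Y m))
    (hZ : ∀ m, Measurable (Z m))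
    (hcf : ∀ t0 t1 t2 : ℝ, Tendsto (fun m => ∫ ω, Complex.exp (((t0 * X m ω + t1 * Y m ω + t2 * Z m ω : ℝ) : ℂ)
      * Complex.I) ∂P m) atTop (𝓝 (Complex.exp ((t0 : ℂ) * Complex.I) *
        ((Real.exp (-(s * (t0 ^ 2 + t1 ^ 2 + t2 ^ 2) / 2)) : ℝ) : ℂ)))) :
    Tendsto (fun m => ∫ ω, (indLe (Y m ω) (X m ω) - Fs s (X m ω)) * (indLe (Z m ω) (X m ω) - Fs s (X m ω)) ∂P m)
      atTop (𝓝 0) := by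
  set γ := gaussianReal 0 s with hγ
  set κ := (nu3 s).real Cset with hκ
  have hFm := (Fs_continuous s hs).measurable
  have key : ∀ (W : ∀ m, Ω m → ℝ) (_ : ∀ m, Measurable (W m))
    (_ : ∀ t0 t1 : ℝ, Tendsto (fun m => ∫ ω, Complex.exp (((t0 * X m ω + t1 * W m ω : ℝ) : ℂ)
      * Complex.I) ∂P m) atTop (𝓝 (Complex.exp ((t0 : ℂ) * Complex.I) *
        ((Real.exp (-(s * (t0 ^ 2 + t1 ^ 2) / 2)) : ℝ) : ℂ)))),
      Tendsto (fun m => ∫ ω, indLe (W m ω) (X m ω) * Fs s (X m ω) ∂P m) atTop (𝓝 κ) := by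
    intro W hW hc
    have h := three_lim s hs (fun m => (P m).prod γ) (fun m q => X m q.1) (fun m q => W m q.1) (fun m q => q.2)
      (fun m => (hX m).comp measurable_fst) (fun m => (hW m).comp measurable_fst) (fun m => measurable_snd) ?_
    · refine h.congr fun m => ?_
      rw [real_eq_integral ((P m).prod γ) (fun q => X m q.1) (fun q => W m q.1) (fun q => q.2) ((hX m).comp measurable_fst) ((hW m).comp measurable_fst) measurable_snd,
        integral_prod]
      · congr 1
        ext ω
        simp only
        rw [integral_const_mul, Fs_eq]
      · refine bdd_int _ ?_ 1 fun q => mul_bd (indLe_nonneg _ _) (indLe_le_one _ _) (indLe_nonneg _ _) (indLe_le_one _ _)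
        exact (indLe_measurable ((hW m).comp measurable_fst) ((hX m).comp measurable_fst)).mul
          (indLe_measurable measurable_snd ((hX m).comp measurable_fst))
    · intro t0 t1 t2
      have := (hc t0 t1).mul_const ((Real.exp (-(s * t2 ^ 2 / 2)) : ℝ) : ℂ)
      have e : Complex.exp ((t0 : ℂ) * Complex.I) * ((Real.exp (-(s * (t0 ^ 2 + t1 ^ 2) / 2)) : ℝ) : ℂ)
          * ((Real.exp (-(s * t2 ^ 2 / 2)) : ℝ) : ℂ) = Complex.exp ((t0 : ℂ) * Complex.I) *
        ((Real.exp (-(s * (t0 ^ 2 + t1 ^ 2 + t2 ^ 2) / 2)) : ℝ) : ℂ) := by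
        rw [mul_assoc, ← Complex.ofReal_mul, ← Real.exp_add]
        congr 3; ring
      rw [e] at this
      refine this.congr fun m => ?_
      rw [← gauss_cf, ← integral_prod_mul]
      congr 1
      ext q
      rw [← Complex.exp_add]
      congr 1
      push_cast
      ring
  have hA := three_lim s hs P X Y Z hX hY hZ hcf
  have hB := key Y hY (fun t0 t1 => by simpa using hcf t0 t1 0)
  have hC := key Z hZ (fun t0 t1 => by simpa using hcf t0 0 t1)
  have hD : Tendsto (fun m => ∫ ω, Fs s (X m ω) * Fs s (X m ω) ∂P m) atTop (𝓝 κ) := by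
    have h := three_lim s hs (fun m => (P m).prod (γ.prod γ)) (fun m q => X m q.1) (fun m q => q.2.1) (fun m q => q.2.2)
      (fun m => (hX m).comp measurable_fst) (fun m => measurable_fst.comp measurable_snd)
      (fun m => measurable_snd.comp measurable_snd) ?_
    · refine h.congr fun m => ?_
      rw [real_eq_integral ((P m).prod (γ.prod γ)) (fun q => X m q.1) (fun q => q.2.1) (fun q => q.2.2) ((hX m).comp measurable_fst) (measurable_fst.comp measurable_snd)
        (measurable_snd.comp measurable_snd), integral_prod]
      · congr 1
        ext ω
        simp only
        rw [integral_prod_mul (fun y => indLe y (X m ω)) (fun y => indLe y (X m ω)), Fs_eq]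
      · refine bdd_int _ ?_ 1 fun q => mul_bd (indLe_nonneg _ _) (indLe_le_one _ _) (indLe_nonneg _ _) (indLe_le_one _ _)
        exact (indLe_measurable (measurable_fst.comp measurable_snd) ((hX m).comp measurable_fst)).mul
          (indLe_measurable (measurable_snd.comp measurable_snd) ((hX m).comp measurable_fst))
    · intro t0 t1 t2
      have := (hcf t0 0 0).mul_const (((Real.exp (-(s * t1 ^ 2 / 2)) : ℝ) : ℂ) * ((Real.exp (-(s * t2 ^ 2 / 2)) : ℝ) : ℂ))
      have e : Complex.exp ((t0 : ℂ) * Complex.I) * ((Real.exp (-(s * (t0 ^ 2 + 0 ^ 2 + 0 ^ 2) / 2)) : ℝ) : ℂ)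
          * (((Real.exp (-(s * t1 ^ 2 / 2)) : ℝ) : ℂ) * ((Real.exp (-(s * t2 ^ 2 / 2)) : ℝ) : ℂ)) = Complex.exp ((t0 : ℂ) * Complex.I) *
        ((Real.exp (-(s * (t0 ^ 2 + t1 ^ 2 + t2 ^ 2) / 2)) : ℝ) : ℂ) := by
        rw [mul_assoc, ← Complex.ofReal_mul, ← Complex.ofReal_mul, ← Real.exp_add, ← Real.exp_add]
        congr 3; ring
      rw [e] at this
      refine this.congr fun m => ?_
      rw [← gauss_cf, ← gauss_cf, ← integral_prod_mul, ← integral_prod_mul]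
      congr 1
      ext q
      rw [← Complex.exp_add, ← Complex.exp_add]
      congr 1
      push_cast
      ring
  have hall := ((hA.sub hB).sub hC).add hD
  have e0 : κ - κ - κ + κ = 0 := by ring
  rw [e0] at hall
  refine hall.congr fun m => ?_
  rw [real_eq_integral _ _ _ _ (hX m) (hY m) (hZ m)]
  have mY := indLe_measurable (hY m) (hX m)
  have mZ := indLe_measurable (hZ m) (hX m)
  have mF : Measurable (fun ω => Fs s (X m ω)) := hFm.comp (hX m)
  have i1 : Integrable (fun ω => indLe (Y m ω) (X m ω) * indLe (Z m ω) (X m ω)) (P m) := bdd_int (P m) (mY.mul mZ) 1 fun ω => mul_bd (indLe_nonneg _ _) (indLe_le_one _ _) (indLe_nonneg _ _) (indLe_le_one _ _)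
  have i2 : Integrable (fun ω => indLe (Y m ω) (X m ω) * Fs s (X m ω)) (P m) := bdd_int (P m) (mY.mul mF) 1 fun ω => mul_bd (indLe_nonneg _ _) (indLe_le_one _ _) (Fs_nonneg _ _) (Fs_le_one _ _)
  have i3 : Integrable (fun ω => indLe (Z m ω) (X m ω) * Fs s (X m ω)) (P m) := bdd_int (P m) (mZ.mul mF) 1 fun ω => mul_bd (indLe_nonneg _ _) (indLe_le_one _ _) (Fs_nonneg _ _) (Fs_le_one _ _)
  have i4 : Integrable (fun ω => Fs s (X m ω) * Fs s (X m ω)) (P m) := bdd_int (P m) (mF.mul mF) 1 fun ω => mul_bd (Fs_nonneg _ _) (Fs_le_one _ _) (Fs_nonneg _ _) (Fs_le_one _ _)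
  have i12 : Integrable (fun ω => indLe (Y m ω) (X m ω) * indLe (Z m ω) (X m ω) - indLe (Y m ω) (X m ω) * Fs s (X m ω)) (P m) := i1.sub i2
  have i123 : Integrable (fun ω => indLe (Y m ω) (X m ω) * indLe (Z m ω) (X m ω) - indLe (Y m ω) (X m ω) * Fs s (X m ω) - indLe (Z m ω) (X m ω) * Fs s (X m ω)) (P m) := i12.sub i3
  rw [← integral_sub i1 i2, ← integral_sub i12 i3, ← integral_add i123 i4]
  congr 1
  ext ω
  ring

lemma final_int (α : ℝ) (hα : 0 < α) (f : BoundedContinuousFunction ℝ ℝ) :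
    ∫ x, f (Fs α.toNNReal x) ∂gaussianReal 1 α.toNNReal
      = ∫ z, f (Phi (1 / Real.sqrt α + z)) ∂gaussianReal 0 1 := by
  have hs : α.toNNReal ≠ 0 := by simpa using hα
  have hsq : 0 < Real.sqrt α := Real.sqrt_pos.2 hα
  have hm1 : (gaussianReal 0 1).map (fun z => Real.sqrt α * z) = gaussianReal 0 α.toNNReal := by
    rw [gaussianReal_map_const_mul]
    congr 1
    · simp
    · ext; simp [Real.sq_sqrt hα.le, hα.le]
  have hm2 : (gaussianReal 0 1).map (fun z => Real.sqrt α * z + 1) = gaussianReal 1 α.toNNReal := by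
    have : (gaussianReal 0 α.toNNReal).map (fun x => x + 1) = gaussianReal (0 + 1) α.toNNReal :=
      gaussianReal_map_add_const 1
    rw [zero_add, ← hm1, Measure.map_map (by fun_prop) (by fun_prop)] at this
    exact this
  have hfc : Continuous (fun x => f (Fs α.toNNReal x)) := f.continuous.comp (Fs_continuous _ hs)
  rw [← hm2, integral_map (by fun_prop) hfc.aestronglyMeasurable]
  congr 1
  ext z
  congr 1
  unfold Fs Phi
  rw [← hm1, Measure.real, Measure.map_apply (by fun_prop) measurableSet_Iic]
  congr 2
  ext y
  simp only [Set.mem_preimage, Set.mem_Iic]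
  have : Real.sqrt α * z + 1 = Real.sqrt α * (1 / Real.sqrt α + z) := by field_simp; ring
  rw [this, mul_le_mul_iff_right₀ hsq]



lemma scoreX_measurable {d n : ℕ} (j i : Fin n) :
    Measurable (fun p : (Fin n → Fin d → ℝ) × (Fin n → Fin d → ℝ) => scoreX p.1 p.2 j i) := by
  unfold scoreX Wcross
  simp only [dotProduct, mulVec, Matrix.of_apply]
  fun_prop

lemma var_bound {Ω : Type*} [MeasurableSpace Ω] (P : Measure Ω) [IsProbabilityMeasure P]
    {n : ℕ} (hn : 2 ≤ n) (I : Fin n) (h : Fin n → Ω → ℝ) (hm : ∀ j, Measurable (h j))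
    (hb : ∀ j ω, |h j ω| ≤ 1) (C : ℝ) (hC : 0 ≤ C)
    (hcov : ∀ j k, j ≠ I → k ≠ I → j ≠ k → |∫ ω, h j ω * h k ω ∂P| ≤ C) :
    ∫ ω, ((∑ j ∈ Finset.univ.erase I, h j ω) / ((n : ℝ) - 1)) ^ 2 ∂P ≤ 1 / ((n : ℝ) - 1) + C := by
  have hn1 : (0 : ℝ) < (n : ℝ) - 1 := by
    have : (2 : ℝ) ≤ n := by exact_mod_cast hn
    linarith
  have hcard : ((Finset.univ.erase I).card : ℝ) = (n : ℝ) - 1 := by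
    rw [Finset.card_erase_of_mem (Finset.mem_univ _), Finset.card_univ, Fintype.card_fin,
      Nat.cast_sub (by omega)]
    simp
  have hbd : ∀ j k ω, |h j ω * h k ω| ≤ 1 := by
    intro j k ω
    rw [abs_mul]
    exact mul_le_one₀ (hb _ _) (abs_nonneg _) (hb _ _)
  have hi : ∀ j k, Integrable (fun ω => h j ω * h k ω) P := fun j k =>
    bdd_int P ((hm j).mul (hm k)) 1 (hbd j k)
  have e : ∀ ω, ((∑ j ∈ Finset.univ.erase I, h j ω) / ((n : ℝ) - 1)) ^ 2
      = (∑ j ∈ Finset.univ.erase I, ∑ k ∈ Finset.univ.erase I, h j ω * h k ω) / ((n : ℝ) - 1) ^ 2 := by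
    intro ω
    rw [div_pow, pow_two (∑ j ∈ _, _), Finset.sum_mul_sum]
  simp_rw [e]
  rw [integral_div, integral_finsetSum _ (fun j _ => integrable_finsetSum _ fun k _ => hi j k)]
  simp_rw [integral_finsetSum _ (fun k _ => hi _ k)]
  rw [div_le_iff₀ (by positivity)]
  have hle : ∀ j ∈ Finset.univ.erase I, ∀ k ∈ Finset.univ.erase I,
      ∫ ω, h j ω * h k ω ∂P ≤ (if j = k then 1 else 0) + C := by
    intro j hj k hk
    by_cases hjk : j = k
    · have : ∫ ω, h j ω * h k ω ∂P ≤ ∫ ω, (1 : ℝ) ∂P :=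
        integral_mono (hi j k) (integrable_const _) fun ω => (abs_le.1 (hbd j k ω)).2
      simp only [integral_const, probReal_univ, smul_eq_mul, mul_one] at this
      simp only [hjk, if_true]
      rw [hjk] at this
      linarith
    · simp only [hjk, if_false, zero_add]
      exact (abs_le.1 (hcov j k (Finset.ne_of_mem_erase hj) (Finset.ne_of_mem_erase hk) hjk)).2
  calc ∑ j ∈ Finset.univ.erase I, ∑ k ∈ Finset.univ.erase I, ∫ ω, h j ω * h k ω ∂P
      ≤ ∑ j ∈ Finset.univ.erase I, ∑ k ∈ Finset.univ.erase I, ((if j = k then 1 else 0) + C) :=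
        Finset.sum_le_sum fun j hj => Finset.sum_le_sum fun k hk => hle j hj k hk
    _ = ∑ j ∈ Finset.univ.erase I, (1 + ((n : ℝ) - 1) * C) := by
        refine Finset.sum_congr rfl fun j hj => ?_
        rw [Finset.sum_add_distrib, Finset.sum_const, nsmul_eq_mul, hcard, Finset.sum_ite_eq, if_pos hj]
    _ = ((n : ℝ) - 1) * (1 + ((n : ℝ) - 1) * C) := by
        rw [Finset.sum_const, nsmul_eq_mul, hcard]
    _ = (1 / ((n : ℝ) - 1) + C) * ((n : ℝ) - 1) ^ 2 := by
        field_simp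

lemma test_bound (f : BoundedContinuousFunction ℝ ℝ) (ε : ℝ) (hε : 0 < ε) :
    ∃ L : ℝ, 0 ≤ L ∧ ∀ x y : ℝ, 0 ≤ x → x ≤ 1 → 0 ≤ y → y ≤ 1 → |f x - f y| ≤ ε + L * (x - y) ^ 2 := by
  have huc : UniformContinuousOn f (Set.Icc (0 : ℝ) 1) :=
    isCompact_Icc.uniformContinuousOn_of_continuous f.continuous.continuousOn
  rw [Metric.uniformContinuousOn_iff] at huc
  obtain ⟨δ, hδ, H⟩ := huc ε hε
  refine ⟨2 * ‖f‖ / δ ^ 2, by positivity, fun x y hx hx1 hy hy1 => ?_⟩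
  by_cases hxy : |x - y| < δ
  · have := H x ⟨hx, hx1⟩ y ⟨hy, hy1⟩ (by rwa [Real.dist_eq])
    rw [Real.dist_eq] at this
    have h2 : 0 ≤ 2 * ‖f‖ / δ ^ 2 * (x - y) ^ 2 := by positivity
    linarith
  · push Not at hxy
    have h1 : |f x - f y| ≤ 2 * ‖f‖ := by
      have := f.dist_le_two_norm x y
      rwa [Real.dist_eq] at this
    have h2 : δ ^ 2 ≤ (x - y) ^ 2 := by
      rw [← sq_abs (x - y)]
      exact pow_le_pow_left₀ hδ.le hxy 2
    have h3 : 2 * ‖f‖ ≤ 2 * ‖f‖ / δ ^ 2 * (x - y) ^ 2 := by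
      rw [div_mul_eq_mul_div, le_div_iff₀ (by positivity)]
      exact mul_le_mul_of_nonneg_left h2 (by positivity)
    linarith

lemma percentile_eq {d n : ℕ} (p : (Fin n → Fin d → ℝ) × (Fin n → Fin d → ℝ)) (i : Fin n) :
    percentile p i = (∑ j ∈ Finset.univ.erase i, indLe (scoreX p.1 p.2 j i) (scoreX p.1 p.2 i i)) / ((n : ℝ) - 1) := rfl

lemma percentile_measurable {d n : ℕ} (i : Fin n) :
    Measurable (fun p : (Fin n → Fin d → ℝ) × (Fin n → Fin d → ℝ) => percentile p i) := by
  simp only [percentile_eq]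
  exact (Finset.measurable_fun_sum _ fun j _ => indLe_measurable (scoreX_measurable j i) (scoreX_measurable i i)).div_const _

lemma card_er {n : ℕ} (hn : 2 ≤ n) (I : Fin n) : ((Finset.univ.erase I).card : ℝ) = (n : ℝ) - 1 := by
  rw [Finset.card_erase_of_mem (Finset.mem_univ _), Finset.card_univ, Fintype.card_fin,
      Nat.cast_sub (by omega)]
  simp

lemma percentile_mem {d n : ℕ} (hn : 2 ≤ n) (p : (Fin n → Fin d → ℝ) × (Fin n → Fin d → ℝ)) (i : Fin n) :
    0 ≤ percentile p i ∧ percentile p i ≤ 1 := by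
  have hn1 : (0 : ℝ) < (n : ℝ) - 1 := by
    have : (2 : ℝ) ≤ n := by exact_mod_cast hn
    linarith
  rw [percentile_eq]
  refine ⟨div_nonneg (Finset.sum_nonneg fun j _ => indLe_nonneg _ _) hn1.le, ?_⟩
  rw [div_le_one hn1, ← card_er hn i]
  have := Finset.sum_le_sum (s := Finset.univ.erase i) (g := fun _ => (1 : ℝ))
    fun j _ => indLe_le_one (scoreX p.1 p.2 j i) (scoreX p.1 p.2 i i)
  simpa using this

lemma main_aux (α : ℝ) (hα : 0 < α) (n d : ℕ → ℕ)
    (hn : Tendsto n atTop atTop) (hd : Tendsto d atTop atTop)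
    (hlim : Tendsto (fun m => (n m : ℝ) / (d m : ℝ) ^ 2) atTop (𝓝 α))
    (hn3 : ∀ m, 3 ≤ n m) (hd0 : ∀ m, 0 < d m) (I : ∀ m, Fin (n m))
    (f : BoundedContinuousFunction ℝ ℝ) :
      Tendsto (fun m => ∫ p, f (percentile p (I m)) ∂gaussianModel (d m) (n m)) atTop
        (𝓝 (∫ z, f (Phi (1 / Real.sqrt α + z)) ∂gaussianReal 0 1)) := by
  set s := α.toNNReal with hsdef
  have hs : s ≠ 0 := by simpa [hsdef] using hα
  have hsα : (s : ℝ) = α := by simp [hsdef, hα.le]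
  have hFc := Fs_continuous s hs
  have hFm := hFc.measurable
  let h : ∀ m, Fin (n m) → ((Fin (n m) → Fin (d m) → ℝ) × (Fin (n m) → Fin (d m) → ℝ)) → ℝ := fun m j p =>
    indLe (scoreX p.1 p.2 j (I m)) (scoreX p.1 p.2 (I m) (I m)) - Fs s (scoreX p.1 p.2 (I m) (I m))
  have hFX : ∀ m, Measurable (fun p : (Fin (n m) → Fin (d m) → ℝ) × (Fin (n m) → Fin (d m) → ℝ) =>
      Fs s (scoreX p.1 p.2 (I m) (I m))) := fun m => hFm.comp (scoreX_measurable _ _)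
  have hhm : ∀ m j, Measurable (h m j) := fun m j =>
    (indLe_measurable (scoreX_measurable _ _) (scoreX_measurable _ _)).sub (hFX m)
  have hhb : ∀ m j p, |h m j p| ≤ 1 := by
    intro m j p
    simp only [h]
    rw [abs_le]
    constructor <;> linarith [indLe_nonneg (scoreX p.1 p.2 j (I m)) (scoreX p.1 p.2 (I m) (I m)),
      indLe_le_one (scoreX p.1 p.2 j (I m)) (scoreX p.1 p.2 (I m) (I m)),
      Fs_nonneg s (scoreX p.1 p.2 (I m) (I m)), Fs_le_one s (scoreX p.1 p.2 (I m) (I m))]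
  -- the maximizing pair
  have hpair : ∀ m, ∃ q : Fin (n m) × Fin (n m), (I m ≠ q.1 ∧ I m ≠ q.2 ∧ q.1 ≠ q.2) ∧
      ∀ j k, j ≠ I m → k ≠ I m → j ≠ k → |∫ p, h m j p * h m k p ∂gaussianModel (d m) (n m)|
        ≤ |∫ p, h m q.1 p * h m q.2 p ∂gaussianModel (d m) (n m)| := by
    intro m
    let S : Finset (Fin (n m) × Fin (n m)) := Finset.univ.filter fun q => I m ≠ q.1 ∧ I m ≠ q.2 ∧ q.1 ≠ q.2
    have hne : S.Nonempty := by
      have hc : 2 < (Finset.univ : Finset (Fin (n m))).card := by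
        rw [Finset.card_univ, Fintype.card_fin]; exact hn3 m
      have h1 : 1 < (Finset.univ.erase (I m)).card := by
        rw [Finset.card_erase_of_mem (Finset.mem_univ _)]; omega
      obtain ⟨a, ha, b, hb, hab⟩ := Finset.one_lt_card.1 h1
      exact ⟨(a, b), by
        simp only [S, Finset.mem_filter, Finset.mem_univ, true_and]
        exact ⟨(Finset.ne_of_mem_erase ha).symm, (Finset.ne_of_mem_erase hb).symm, hab⟩⟩
    obtain ⟨q, hq, hmax⟩ := Finset.exists_max_image S
      (fun q => |∫ p, h m q.1 p * h m q.2 p ∂gaussianModel (d m) (n m)|) hne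
    refine ⟨q, by simpa [S] using hq, fun j k hj hk hjk => ?_⟩
    exact hmax (j, k) (by
      simp only [S, Finset.mem_filter, Finset.mem_univ, true_and]
      exact ⟨hj.symm, hk.symm, hjk⟩)
  choose q hq hqmax using hpair
  have hcf := fun t0 t1 t2 => charfun_lim α n d hd hd0 hlim I (fun m => (q m).1) (fun m => (q m).2)
    (fun m => (hq m).1) (fun m => (hq m).2.1) (fun m => (hq m).2.2) t0 t1 t2
  rw [← hsα] at hcf
  have hH := H_lim s hs (fun m => gaussianModel (d m) (n m))
    (fun m p => scoreX p.1 p.2 (I m) (I m)) (fun m p => scoreX p.1 p.2 (q m).1 (I m))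
    (fun m p => scoreX p.1 p.2 (q m).2 (I m)) (fun m => scoreX_measurable _ _)
    (fun m => scoreX_measurable _ _) (fun m => scoreX_measurable _ _) hcf
  have hX1 := one_lim s (fun m => gaussianModel (d m) (n m))
    (fun m p => scoreX p.1 p.2 (I m) (I m)) (fun m => scoreX_measurable _ _)
    (fun t0 => by simpa using hcf t0 0 0) (f.compContinuous ⟨Fs s, hFc⟩)
  have hfin : ∫ x, (f.compContinuous ⟨Fs s, hFc⟩) x ∂gaussianReal 1 s
      = ∫ z, f (Phi (1 / Real.sqrt α + z)) ∂gaussianReal 0 1 := final_int α hα f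
  rw [hfin] at hX1
  -- second moment
  have hvar : Tendsto (fun m => ∫ p, (percentile p (I m) - Fs s (scoreX p.1 p.2 (I m) (I m))) ^ 2
      ∂gaussianModel (d m) (n m)) atTop (𝓝 0) := by
    have hup : Tendsto (fun m => 1 / ((n m : ℝ) - 1) +
        |∫ p, h m (q m).1 p * h m (q m).2 p ∂gaussianModel (d m) (n m)|) atTop (𝓝 0) := by
      have h1 : Tendsto (fun m => (n m : ℝ) - 1) atTop atTop :=
        tendsto_atTop_add_const_right _ (-1) (tendsto_natCast_atTop_atTop.comp hn)
      have h2 := h1.inv_tendsto_atTop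
      have h3 := hH.abs
      rw [abs_zero] at h3
      simpa using h2.add h3
    refine squeeze_zero (fun m => integral_nonneg fun p => sq_nonneg _) (fun m => ?_) hup
    refine le_trans (le_of_eq ?_) (var_bound (gaussianModel (d m) (n m)) (by have := hn3 m; omega) (I m) (h m) (hhm m) (hhb m)
      _ (abs_nonneg _) (hqmax m))
    congr 1
    ext p
    congr 1
    have hn1 : (0 : ℝ) < (n m : ℝ) - 1 := by
      have : (3 : ℝ) ≤ n m := by exact_mod_cast hn3 m
      linarith
    simp only [h]
    rw [Finset.sum_sub_distrib, Finset.sum_const, nsmul_eq_mul, card_er (by have := hn3 m; omega), percentile_eq]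
    field_simp
  -- comparison
  have hdiff : Tendsto (fun m => ∫ p, f (percentile p (I m)) ∂gaussianModel (d m) (n m)
      - ∫ p, f (Fs s (scoreX p.1 p.2 (I m) (I m))) ∂gaussianModel (d m) (n m)) atTop (𝓝 0) := by
    rw [Metric.tendsto_atTop]
    intro ε hε
    obtain ⟨L, hL, hfb⟩ := test_bound f (ε / 2) (by positivity)
    have h1 := hvar.const_mul L
    rw [mul_zero] at h1
    obtain ⟨N, hN⟩ := (Metric.tendsto_atTop.1 h1) (ε / 2) (by positivity)
    refine ⟨N, fun m hm => ?_⟩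
    have h2 := hN m hm
    rw [Real.dist_eq, sub_zero] at h2 ⊢
    have hpm := percentile_measurable (d := d m) (I m)
    have hmem := fun p => percentile_mem (d := d m) (show 2 ≤ n m by have := hn3 m; omega) p (I m)
    have i1 : Integrable (fun p => f (percentile p (I m))) (gaussianModel (d m) (n m)) :=
      bdd_int _ (f.continuous.measurable.comp hpm) ‖f‖ fun p => f.norm_coe_le_norm _
    have i2 : Integrable (fun p => f (Fs s (scoreX p.1 p.2 (I m) (I m)))) (gaussianModel (d m) (n m)) :=
      bdd_int _ (f.continuous.measurable.comp (hFX m)) ‖f‖ fun p => f.norm_coe_le_norm _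
    have i3 : Integrable (fun p => (percentile p (I m) - Fs s (scoreX p.1 p.2 (I m) (I m))) ^ 2)
        (gaussianModel (d m) (n m)) := by
      refine bdd_int _ ((hpm.sub (hFX m)).pow_const 2) 1 fun p => ?_
      rw [abs_of_nonneg (sq_nonneg _), sq_le_one_iff_abs_le_one, abs_le]
      constructor <;> linarith [(hmem p).1, (hmem p).2,
        Fs_nonneg s (scoreX p.1 p.2 (I m) (I m)), Fs_le_one s (scoreX p.1 p.2 (I m) (I m))]
    rw [← integral_sub i1 i2]
    have h3 : |∫ p, (f (percentile p (I m)) - f (Fs s (scoreX p.1 p.2 (I m) (I m)))) ∂gaussianModel (d m) (n m)|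
        ≤ ∫ p, (ε / 2 + L * (percentile p (I m) - Fs s (scoreX p.1 p.2 (I m) (I m))) ^ 2) ∂gaussianModel (d m) (n m) := by
      refine (abs_integral_le_integral_abs).trans (integral_mono (i1.sub i2).abs
        ((integrable_const _).add (i3.const_mul L)) fun p => ?_)
      exact hfb _ _ (hmem p).1 (hmem p).2 (Fs_nonneg _ _) (Fs_le_one _ _)
    rw [integral_add (integrable_const _) (i3.const_mul L), integral_const_mul, integral_const] at h3
    simp only [probReal_univ, smul_eq_mul, one_mul] at h3
    linarith [le_abs_self (L * ∫ p, (percentile p (I m) - Fs s (scoreX p.1 p.2 (I m) (I m))) ^ 2 ∂gaussianModel (d m) (n m))]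
  have := hdiff.add hX1
  rw [zero_add] at this
  refine this.congr fun m => ?_
  exact sub_add_cancel _ _

/-- **One-column percentile limit.** If `n, d → ∞` with `n/d² → α ∈ (0,∞)`, then for
each fixed index `i` the signal percentile `Ω_i^{(n)}` converges in distribution to
`Ω = Φ(α^{-1/2} + Z)`, `Z` standard normal (the limit law with CDF
`ω ↦ Φ(Φ^{-1}(ω) - α^{-1/2})` on `(0,1)`). Convergence in distribution is expressed
through bounded continuous test functions. -/
theorem percentile_one_column_limit (α : ℝ) (hα : 0 < α) (n d : ℕ → ℕ)
    (hn : Tendsto n atTop atTop) (hd : Tendsto d atTop atTop)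
    (hlim : Tendsto (fun m => (n m : ℝ) / (d m : ℝ) ^ 2) atTop (𝓝 α)) (i : ℕ) :
    ∀ f : BoundedContinuousFunction ℝ ℝ,
      Tendsto (fun m => ∫ p, f (if h : i < n m then percentile p ⟨i, h⟩ else 0)
          ∂gaussianModel (d m) (n m)) atTop
        (𝓝 (∫ z, f (Phi (1 / Real.sqrt α + z)) ∂gaussianReal 0 1)) := by
  intro f
  obtain ⟨M1, hM1⟩ := eventually_atTop.1 (hn.eventually_ge_atTop (i + 4))
  obtain ⟨M2, hM2⟩ := eventually_atTop.1 (hd.eventually_ge_atTop 1)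
  rw [← tendsto_add_atTop_iff_nat (max M1 M2)]
  have hsh : Tendsto (fun m => m + max M1 M2) atTop atTop := tendsto_add_atTop_nat _
  have hn' : ∀ m, i + 4 ≤ n (m + max M1 M2) := fun m => hM1 _ (by omega)
  have hd' : ∀ m, 1 ≤ d (m + max M1 M2) := fun m => hM2 _ (by omega)
  have h := main_aux α hα (fun m => n (m + max M1 M2)) (fun m => d (m + max M1 M2))
    (hn.comp hsh) (hd.comp hsh) (hlim.comp hsh) (fun m => by have := hn' m; omega) hd'
    (fun m => ⟨i, by have := hn' m; omega⟩) f
  refine h.congr fun m => ?_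
  have hi : i < n (m + max M1 M2) := by have := hn' m; omega
  simp only [hi, dif_pos]

end
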